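/- Let 1 ≤ d < n be integers and U ⊆ ℝ^n an open set. Let {E_k} be a sequence of closed subsets of ℝ^n such that the sets U ∩ E_k are all contained in one fixed bounded set, limsup_{k→∞} H^d(U ∩ E_k) < ∞, and the measures H^d restricted to U ∩ E_k converge weakly to a Radon measure μ. Then for every τ > 0 there exist a strictly increasing sequence of indices {k_i}, a compact set E ⊆ ℝ^n, and deformations φ_i ∈ D(ℝ^n,U) with sup_{x∈ℝ^n} |φ_i(x) − x| ≤ τ, such that: (i) lim_{i→∞} H^d(φ_i(E_{k_i}) △ E_{k_i}) = 0; (ii) U ∩ spt μ ⊆ E and H^d(U ∩ E ∖ spt μ) = 0; and (iii) the sets φ_i(U ∩ E_{k_i}) converge to E locally in U in Hausdorff distance, meaning that for every compact K ⊆ U and every η > 0, for all sufficiently large i one has φ_i(U ∩ E_{k_i}) ∩ K ⊆ {y : dist(y, E) ≤ η} and E ∩ K ⊆ {y : dist(y, φ_i(U ∩ E_{k_i})) ≤ η}. -/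

import Mathlib

open MeasureTheory Metric Set Filter Topology
open scoped ENNReal NNReal

noncomputable section

/-- Euclidean space `ℝ^n`. -/
abbrev Euc (n : ℕ) := EuclideanSpace ℝ (Fin n)

/-- A deformation on `ℝⁿ` in the open set `U`: a Lipschitz map `φ : ℝⁿ → ℝⁿ` homotopic to the
identity such that the closure of `W_φ = {x | φ x ≠ x}` is compact and contained in `U`. -/
def IsDeformation (n : ℕ) (U : Set (Euc n)) (φ : Euc n → Euc n) : Prop :=
  (∃ K : ℝ≥0, LipschitzWith K φ) ∧
  (∃ hc : Continuous φ, (ContinuousMap.id (Euc n)).Homotopic ⟨φ, hc⟩) ∧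
  IsCompact (closure {x | φ x ≠ x}) ∧
  closure {x | φ x ≠ x} ⊆ U

/-- Membership in the class `QM(ℝⁿ, U, M, ε)`: `H^d`-restriction to `E` is locally finite,
`E ∩ U` is relatively closed in `U`, and for every deformation `φ` on `ℝⁿ` in `U` one has
`H^d(E ∩ W_φ) ≤ M(r) · H^d(φ(E ∩ W_φ)) + ε(r)` with `r = diam (W_φ ∪ φ(W_φ))`. -/
def MemQM (n : ℕ) (d : ℕ) (U : Set (Euc n)) (M ε : ℝ → ℝ≥0∞) (E : Set (Euc n)) : Prop :=
  IsLocallyFiniteMeasure ((μH[(d : ℝ)] : Measure (Euc n)).restrict E) ∧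
  (∃ F : Set (Euc n), IsClosed F ∧ E ∩ U = F ∩ U) ∧
  ∀ φ : Euc n → Euc n, IsDeformation n U φ →
    μH[(d : ℝ)] (E ∩ {x | φ x ≠ x}) ≤
      M (diam ({x | φ x ≠ x} ∪ φ '' {x | φ x ≠ x})) *
        μH[(d : ℝ)] (φ '' (E ∩ {x | φ x ≠ x})) +
      ε (diam ({x | φ x ≠ x} ∪ φ '' {x | φ x ≠ x}))

/-- Weak convergence of Radon measures: testing against continuous compactly supported
functions. -/
def WeakConv (n : ℕ) (μs : ℕ → Measure (Euc n)) (μ : Measure (Euc n)) : Prop :=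
  ∀ f : Euc n → ℝ, Continuous f → HasCompactSupport f →
    Tendsto (fun k => ∫ x, f x ∂(μs k)) atTop (𝓝 (∫ x, f x ∂μ))

/-- The support `spt μ` of a measure: points all of whose neighborhoods have positive measure. -/
def msupport (n : ℕ) (μ : Measure (Euc n)) : Set (Euc n) :=
  {x | ∀ r : ℝ, 0 < r → 0 < μ (ball x r)}

/-- `ω_d`: the Lebesgue measure of the unit ball of `ℝ^d`. -/
def ωb (d : ℕ) : ℝ≥0∞ := volume (ball (0 : Euc d) 1)

/-- Upper `d`-density `Θ^{*d}(μ,x) = limsup_{r→0+} μ(B̄(x,r))/(ω_d r^d)`. -/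
def upperDensity (n : ℕ) (d : ℕ) (μ : Measure (Euc n)) (x : Euc n) : ℝ≥0∞ :=
  limsup (fun r : ℝ => μ (closedBall x r) / (ωb d * ENNReal.ofReal r ^ d)) (𝓝[>] (0 : ℝ))

/-- Lower `d`-density `Θ_*^d(μ,x) = liminf_{r→0+} μ(B̄(x,r))/(ω_d r^d)`. -/
def lowerDensity (n : ℕ) (d : ℕ) (μ : Measure (Euc n)) (x : Euc n) : ℝ≥0∞ :=
  liminf (fun r : ℝ => μ (closedBall x r) / (ωb d * ENNReal.ofReal r ^ d)) (𝓝[>] (0 : ℝ))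

/-- `limsup_{k→∞}` of a sequence of real-valued gauge functions, with values in `[0,∞]`. -/
def limsupFn (Ms : ℕ → ℝ → ℝ) : ℝ → ℝ≥0∞ :=
  fun r => Filter.limsup (fun k => ENNReal.ofReal (Ms k r)) atTop

/-- Right limit at `0` of a nondecreasing function `[0,∞) → [0,∞]`, i.e. `M(0+)`. -/
def rightLim0 (M : ℝ → ℝ≥0∞) : ℝ≥0∞ := ⨅ r ∈ Set.Ioi (0 : ℝ), M r

namespace Haircut

lemma exists_lam {ι : Type*} [Fintype ι] (d : ℕ) (c : ι → ℝ) :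
    ∃ l : ℝ, 0 ≤ l ∧ (∀ J : Finset ι, (∀ a ∈ J, l < c a) → J.card ≤ d) ∧
      (0 < l → ∃ J : Finset ι, J.card = d + 1 ∧ ∀ a ∈ J, l ≤ c a) := by
  classical
  let S : Finset ℝ := (insert 0 (Finset.univ.image c)).filter
    (fun t => t = 0 ∨ (0 < t ∧ ∃ J : Finset ι, J.card = d + 1 ∧ ∀ a ∈ J, t ≤ c a))
  have h0 : (0 : ℝ) ∈ S := by simp [S]
  obtain ⟨l, hl, hmax⟩ := Finset.exists_max_image S id ⟨0, h0⟩
  have hl0 : 0 ≤ l := hmax 0 h0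
  refine ⟨l, hl0, ?_, ?_⟩
  · intro J hJ
    by_contra hcard
    push Not at hcard
    obtain ⟨J', hJ', hc'⟩ := Finset.exists_subset_card_eq (show d + 1 ≤ J.card from hcard)
    have hne : J'.Nonempty := by
      rw [← Finset.card_pos]; omega
    obtain ⟨a, ha, hmin⟩ := Finset.exists_min_image J' c hne
    have hla := hJ a (hJ' ha)
    have : c a ∈ S := by
      simp only [S, Finset.mem_filter, Finset.mem_insert, Finset.mem_image]
      exact ⟨Or.inr ⟨a, Finset.mem_univ _, rfl⟩,
        Or.inr ⟨by linarith, J', hc', fun b hb => hmin b hb⟩⟩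
    have := hmax _ this
    simp only [id] at this
    linarith
  · intro hpos
    simp only [S, Finset.mem_filter] at hl
    rcases hl.2 with h | h
    · exact absurd h hpos.ne'
    · exact h.2

/-- The `(d+1)`-th largest value of `c` (truncated below at `0`). -/
def lam {ι : Type*} [Fintype ι] (d : ℕ) (c : ι → ℝ) : ℝ := (exists_lam d c).choose

section
variable {ι : Type*} [Fintype ι] (d : ℕ) (c : ι → ℝ)

lemma lam_nonneg : 0 ≤ lam d c := (exists_lam d c).choose_spec.1

lemma lam_card {J : Finset ι} (h : ∀ a ∈ J, lam d c < c a) : J.card ≤ d :=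
  (exists_lam d c).choose_spec.2.1 J h

lemma lam_exists (h : 0 < lam d c) :
    ∃ J : Finset ι, J.card = d + 1 ∧ ∀ a ∈ J, lam d c ≤ c a :=
  (exists_lam d c).choose_spec.2.2 h

lemma lam_le_add (c' : ι → ℝ) (e : ℝ) (he : 0 ≤ e) (h : ∀ a, c' a ≤ c a + e) :
    lam d c' ≤ lam d c + e := by
  by_contra hlt
  push Not at hlt
  have h0 := lam_nonneg d c
  obtain ⟨J, hJ, hJ'⟩ := lam_exists d c' (by linarith)
  have := lam_card d c (J := J) (fun a ha => by linarith [hJ' a ha, h a])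
  omega

lemma abs_lam_sub_le (c' : ι → ℝ) (e : ℝ) (he : 0 ≤ e) (h : ∀ a, |c a - c' a| ≤ e) :
    |lam d c - lam d c'| ≤ e := by
  rw [abs_le]
  have h1 := lam_le_add d c c' e he (fun a => by linarith [(abs_le.1 (h a)).1])
  have h2 := lam_le_add d c' c e he (fun a => by linarith [(abs_le.1 (h a)).2])
  constructor <;> linarith

lemma continuous_lam : Continuous (fun c : ι → ℝ => lam d c) := by
  have : LipschitzWith 1 (fun c : ι → ℝ => lam d c) := by
    refine LipschitzWith.of_dist_le_mul (fun x y => ?_)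
    simp only [NNReal.coe_one, one_mul, Real.dist_eq]
    refine abs_lam_sub_le d x y _ dist_nonneg (fun a => ?_)
    rw [← Real.dist_eq]
    exact dist_le_pi_dist x y a
  exact this.continuous

lemma le_lam_zero (a : ι) : c a ≤ lam 0 c := by
  by_contra h
  push Not at h
  have := lam_card 0 c (J := {a}) (by simpa using h)
  simp at this

end

/-- uniform measure on the unit interval -/
abbrev un : Measure ℝ := (volume : Measure ℝ).restrict (Icc 0 1)

instance : IsProbabilityMeasure un := ⟨by simp [un]⟩

/-- uniform measure on the cube -/
abbrev cub (ι : Type*) [Fintype ι] : Measure (ι → ℝ) := Measure.pi (fun _ : ι => un)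

/-- Near-coincidence event. -/
def Ev {ι : Type*} (d : ℕ) (β : ι → ℝ) (r : ℝ) : Set (ι → ℝ) :=
  {p | ∃ J : Finset ι, J.card = d + 1 ∧ ∃ t : ℝ, 0 ≤ t ∧ t ≤ 8 ∧ ∀ a ∈ J, |β a - p a - t| ≤ r}

lemma un_Icc_le (a b : ℝ) : un (Icc a b) ≤ ENNReal.ofReal (b - a) := by
  calc un (Icc a b) ≤ volume (Icc a b) := Measure.restrict_apply_le _ _
    _ = _ := Real.volume_Icc

lemma cub_box {ι : Type*} [Fintype ι] (J : Finset ι) (l u : ι → ℝ) (s : ℝ)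
    (h : ∀ a ∈ J, u a - l a ≤ s) :
    cub ι {p | ∀ a ∈ J, p a ∈ Icc (l a) (u a)} ≤ ENNReal.ofReal s ^ J.card := by
  classical
  have : {p : ι → ℝ | ∀ a ∈ J, p a ∈ Icc (l a) (u a)} =
      Set.pi univ (fun a => if a ∈ J then Icc (l a) (u a) else univ) := by
    ext p
    simp only [mem_ofPred_eq, Set.mem_pi, mem_univ, forall_const]
    refine forall_congr' (fun a => ?_)
    by_cases ha : a ∈ J <;> simp [ha]
  rw [this, Measure.pi_pi]
  calc ∏ a, un (if a ∈ J then Icc (l a) (u a) else univ)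
      ≤ ∏ a, (if a ∈ J then ENNReal.ofReal s else 1) := by
        refine Finset.prod_le_prod' (fun a _ => ?_)
        by_cases ha : a ∈ J
        · simp only [ha, if_true]
          exact (un_Icc_le _ _).trans (ENNReal.ofReal_le_ofReal (h a ha))
        · simp only [ha, if_false]
          exact prob_le_one
    _ = ENNReal.ofReal s ^ J.card := by
        rw [Finset.prod_ite]; simp

lemma Ev_le {ι : Type*} [Fintype ι] (d : ℕ) : ∃ C : ℝ≥0, ∀ (β : ι → ℝ) (r : ℝ), 0 < r →
    cub ι (Ev d β r) ≤ C * ENNReal.ofReal r ^ d := by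
  classical
  refine ⟨(Fintype.card (Finset ι) : ℝ≥0) * (9 * 3 ^ (d + 1)) + 1, fun β r hr => ?_⟩
  rcases le_or_gt r 1 with hr1 | hr1
  swap
  · calc cub ι (Ev d β r) ≤ 1 := prob_le_one
      _ ≤ 1 * ENNReal.ofReal r ^ d := by
        rw [one_mul]
        exact one_le_pow₀ (by rw [← ENNReal.ofReal_one]; exact ENNReal.ofReal_le_ofReal hr1.le)
      _ ≤ _ := by
        gcongr
        push_cast
        exact le_add_self
  let M := ⌊8 / r⌋₊
  have hsub : Ev d β r ⊆ ⋃ J ∈ (Finset.univ.filter (fun J : Finset ι => J.card = d + 1)),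
      ⋃ m ∈ Finset.range (M + 1), {p : ι → ℝ | ∀ a ∈ J, p a ∈
        Icc (β a - m * r - 2 * r) (β a - m * r + r)} := by
    rintro p ⟨J, hJ, t, ht0, ht8, h⟩
    simp only [mem_iUnion]
    refine ⟨J, by simp [hJ], ⌊t / r⌋₊, ?_, ?_⟩
    · rw [Finset.mem_range, Nat.lt_succ_iff]
      exact Nat.floor_le_floor (by gcongr)
    · intro a ha
      have h1 := abs_le.1 (h a ha)
      have h2 : (⌊t / r⌋₊ : ℝ) * r ≤ t := by
        rw [← le_div_iff₀ hr]; exact Nat.floor_le (by positivity)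
      have h3 : t < ((⌊t / r⌋₊ : ℝ) + 1) * r := by
        rw [← div_lt_iff₀ hr]; exact Nat.lt_floor_add_one _
      constructor <;> linarith
  have hM : ((M + 1 : ℕ) : ℝ) * (3 * r) ^ (d + 1) ≤ 9 * 3 ^ (d + 1) * r ^ d := by
    have : (M : ℝ) * r ≤ 8 := by
      rw [← le_div_iff₀ hr]; exact Nat.floor_le (by positivity)
    have h2 : ((M + 1 : ℕ) : ℝ) * r ≤ 9 := by push_cast; nlinarith
    calc ((M + 1 : ℕ) : ℝ) * (3 * r) ^ (d + 1) = (((M + 1 : ℕ) : ℝ) * r) * (3 ^ (d+1) * r ^ d) := by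
          rw [mul_pow]; ring
      _ ≤ 9 * (3 ^ (d+1) * r ^ d) := by gcongr
      _ = _ := by ring
  calc cub ι (Ev d β r) ≤ _ := measure_mono hsub
    _ ≤ ∑ J ∈ (Finset.univ.filter (fun J : Finset ι => J.card = d + 1)),
        ∑ m ∈ Finset.range (M + 1), ENNReal.ofReal (3 * r) ^ (d + 1) := by
        refine (measure_biUnion_finset_le _ _).trans (Finset.sum_le_sum fun J hJ => ?_)
        refine (measure_biUnion_finset_le _ _).trans (Finset.sum_le_sum fun m _ => ?_)
        rw [← (Finset.mem_filter.1 hJ).2]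
        exact cub_box J _ _ _ (fun a _ => by linarith)
    _ ≤ (Fintype.card (Finset ι)) * (((M + 1 : ℕ) : ℝ≥0∞) * ENNReal.ofReal (3 * r) ^ (d + 1)) := by
        simp only [Finset.sum_const, Finset.card_range, nsmul_eq_mul]
        gcongr
        exact Finset.card_filter_le _ _
    _ ≤ (Fintype.card (Finset ι)) * (9 * 3 ^ (d + 1) * ENNReal.ofReal r ^ d) := by
        refine mul_le_mul' le_rfl ?_
        have := ENNReal.ofReal_le_ofReal hM
        rw [ENNReal.ofReal_mul (by positivity), ENNReal.ofReal_pow (by positivity),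
          ENNReal.ofReal_mul (p := 9 * 3 ^ (d + 1)) (by positivity),
          ENNReal.ofReal_mul (p := 9) (by positivity),
          ENNReal.ofReal_pow (p := 3) (by positivity), ENNReal.ofReal_pow hr.le,
          ENNReal.ofReal_natCast] at this
        simpa using this
    _ ≤ _ := by
        push_cast
        rw [add_mul, ← mul_assoc, ← mul_assoc]
        exact le_self_add


set_option linter.unusedSectionVars false

section
variable {ι : Type*} [Fintype ι] {X : Type*} [PseudoMetricSpace X]
  (d : ℕ) (b : ι → X → ℝ) (p : ι → ℝ) (q : ℝ)

/-- truncated weights -/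
def ww (x : X) (a : ι) : ℝ := max 0 (b a x - p a - lam d (fun a => b a x - p a))

/-- outer bump -/
def bo (x : X) : ℝ := max 0 (4 - lam 0 (fun a => b a x))

/-- total weight -/
def DD (x : X) : ℝ := ∑ a, ww d b p x a + max 0 (bo b x - q)

lemma ww_nonneg (x : X) (a : ι) : 0 ≤ ww d b p x a := le_max_left _ _

lemma bo_nonneg (x : X) : 0 ≤ bo b x := le_max_left _ _

lemma sum_ww_nonneg (x : X) : 0 ≤ ∑ a, ww d b p x a :=
  Finset.sum_nonneg fun a _ => ww_nonneg d b p x a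

lemma sum_ww_le (x : X) : ∑ a, ww d b p x a ≤ DD d b p q x :=
  le_add_of_nonneg_right (le_max_left _ _)

lemma ww_le_DD (x : X) (a : ι) : ww d b p x a ≤ DD d b p q x :=
  (Finset.single_le_sum (fun a _ => ww_nonneg d b p x a) (Finset.mem_univ a)).trans
    (sum_ww_le d b p q x)

lemma DD_nonneg (x : X) : 0 ≤ DD d b p q x :=
  (sum_ww_nonneg d b p x).trans (sum_ww_le d b p q x)

lemma ww_le (x : X) (hb : ∀ a, b a x ≤ 8) (hp : ∀ a, 0 ≤ p a) (a : ι) : ww d b p x a ≤ 8 := by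
  have := lam_nonneg d (fun a => b a x - p a)
  exact max_le (by norm_num) (by linarith [hb a, hp a])

lemma bo_le (x : X) : bo b x ≤ 4 := by
  have := lam_nonneg 0 (fun a => b a x)
  exact max_le (by norm_num) (by linarith)

lemma DD_le (x : X) (hb : ∀ a, b a x ≤ 8) (hp : ∀ a, 0 ≤ p a) (hq : 0 ≤ q) :
    DD d b p q x ≤ 8 * Fintype.card ι + 4 := by
  unfold DD
  have h1 : ∑ a, ww d b p x a ≤ ∑ a : ι, (8 : ℝ) :=
    Finset.sum_le_sum fun a _ => ww_le d b p x hb hp a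
  have h2 : max 0 (bo b x - q) ≤ 4 := max_le (by norm_num) (by linarith [bo_le b x])
  simp at h1
  linarith

lemma ww_pos (x : X) (a : ι) (hp : ∀ a, 0 ≤ p a) (h : 0 < ww d b p x a) : 0 < b a x := by
  unfold ww at h
  rw [lt_max_iff] at h
  rcases h with h | h
  · exact absurd h (lt_irrefl _)
  · linarith [lam_nonneg d (fun a => b a x - p a), hp a]

lemma card_ww (x : X) (J : Finset ι) (h : ∀ a ∈ J, 0 < ww d b p x a) : J.card ≤ d := by
  refine lam_card d (fun a => b a x - p a) fun a ha => ?_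
  have := h a ha
  unfold ww at this
  rw [lt_max_iff] at this
  rcases this with h | h
  · exact absurd h (lt_irrefl _)
  · linarith

lemma abs_max_sub (u v : ℝ) : |max 0 u - max 0 v| ≤ |u - v| := by
  simpa using abs_max_sub_max_le_max 0 u 0 v

lemma key (x : X) (hb : ∀ a, b a x ≤ 8) (hp : ∀ a, 0 ≤ p a) (hp1 : ∀ a, p a ≤ 1)
    (hq1 : q ≤ 1) (hD : DD d b p q x < 1) :
    ∃ J : Finset ι, J.card = d + 1 ∧ ∃ t : ℝ, 0 ≤ t ∧ t ≤ 8 ∧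
      ∀ a ∈ J, |b a x - p a - t| ≤ DD d b p q x := by
  have h0 : max 0 (bo b x - q) ≤ DD d b p q x :=
    le_add_of_nonneg_left (sum_ww_nonneg d b p x)
  have h1 : bo b x < 2 := by
    have := le_max_right 0 (bo b x - q)
    linarith
  have h2 : 2 < lam 0 (fun a => b a x) := by
    have := le_max_right 0 (4 - lam 0 (fun a => b a x))
    unfold bo at h1
    linarith
  obtain ⟨J0, hJ0, hJ0'⟩ := lam_exists 0 (fun a => b a x) (by linarith)
  obtain ⟨a0, rfl⟩ := Finset.card_eq_one.1 hJ0
  have h3 := hJ0' a0 (by simp)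
  have h4 := ww_le_DD d b p q x a0
  have h5 : b a0 x - p a0 - lam d (fun a => b a x - p a) ≤ ww d b p x a0 := le_max_right _ _
  have h6 : 0 < lam d (fun a => b a x - p a) := by
    linarith [hp1 a0]
  obtain ⟨J, hJ, hJ'⟩ := lam_exists d _ h6
  refine ⟨J, hJ, _, h6.le, ?_, fun a ha => ?_⟩
  · have : J.Nonempty := by rw [← Finset.card_pos]; omega
    obtain ⟨a, ha⟩ := this
    have := hJ' a ha
    linarith [hb a, hp a]
  · have := hJ' a ha
    rw [abs_of_nonneg (by linarith)]
    exact (le_max_right _ _).trans (ww_le_DD d b p q x a)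

variable (L : ℝ)

lemma ww_lip (hL : 0 ≤ L) (hb : ∀ a x y, |b a x - b a y| ≤ L * dist x y)
    (x y : X) (a : ι) : |ww d b p x a - ww d b p y a| ≤ 2 * L * dist x y := by
  refine (abs_max_sub _ _).trans ?_
  have h1 := abs_lam_sub_le d (fun a => b a x - p a) (fun a => b a y - p a) (L * dist x y)
    (by positivity) (fun a => by simpa using hb a x y)
  have h2 := hb a x y
  rw [abs_le] at *
  constructor <;> linarith

lemma bo_lip (hL : 0 ≤ L) (hb : ∀ a x y, |b a x - b a y| ≤ L * dist x y)
    (x y : X) : |bo b x - bo b y| ≤ L * dist x y := by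
  refine (abs_max_sub _ _).trans ?_
  have h1 := abs_lam_sub_le 0 (fun a => b a x) (fun a => b a y) (L * dist x y)
    (by positivity) (fun a => by simpa using hb a x y)
  rw [abs_le] at *
  constructor <;> linarith

lemma DD_lip (hL : 0 ≤ L) (hb : ∀ a x y, |b a x - b a y| ≤ L * dist x y)
    (x y : X) :
    |DD d b p q x - DD d b p q y| ≤ (2 * Fintype.card ι + 1) * L * dist x y := by
  have h1 : |∑ a, ww d b p x a - ∑ a, ww d b p y a| ≤ Fintype.card ι * (2 * L * dist x y) := by
    rw [← Finset.sum_sub_distrib]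
    refine (Finset.abs_sum_le_sum_abs _ _).trans ?_
    refine (Finset.sum_le_sum fun a _ => ww_lip d b p L hL hb x y a).trans ?_
    simp
  have h2 := (abs_max_sub (bo b x - q) (bo b y - q)).trans
    ((by simp : _ = |bo b x - bo b y|).le.trans (bo_lip b L hL hb x y))
  unfold DD
  rw [abs_le] at *
  constructor <;> linarith

lemma continuous_ww (hb : ∀ a, Continuous (b a)) (a : ι) :
    Continuous (fun z : X × (ι → ℝ) => ww d b z.2 z.1 a) := by
  unfold ww
  have : Continuous (fun z : X × (ι → ℝ) => lam d (fun a => b a z.1 - z.2 a)) :=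
    (continuous_lam d).comp (by fun_prop)
  fun_prop

lemma continuous_bo (hb : ∀ a, Continuous (b a)) : Continuous (bo b) := by
  unfold bo
  have : Continuous (fun z : X => lam 0 (fun a => b a z)) :=
    (continuous_lam 0).comp (by fun_prop)
  fun_prop

lemma continuous_DD (hb : ∀ a, Continuous (b a)) :
    Continuous (fun z : X × ((ι → ℝ) × ℝ) => DD d b z.2.1 z.2.2 z.1) := by
  unfold DD
  have h1 := fun a => (continuous_ww d b hb a).comp
    (show Continuous (fun z : X × ((ι → ℝ) × ℝ) => (z.1, z.2.1)) by fun_prop)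
  have h2 := continuous_bo b hb
  simp only [Function.comp_def] at h1
  fun_prop

end


lemma Ev_le' {ι : Type*} [Fintype ι] (d : ℕ) : ∃ C : ℝ≥0, ∀ (β : ι → ℝ) (r : ℝ), 0 ≤ r →
    cub ι (Ev d β r) ≤ C * ENNReal.ofReal r ^ d := by
  obtain ⟨C, hC⟩ := Ev_le (ι := ι) d
  refine ⟨C, fun β r hr => ?_⟩
  have ht : Tendsto (fun s : ℝ => (C : ℝ≥0∞) * ENNReal.ofReal s ^ d) (𝓝[>] r)
      (𝓝 (C * ENNReal.ofReal r ^ d)) := by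
    refine ENNReal.Tendsto.const_mul ?_ (Or.inr ENNReal.coe_ne_top)
    refine Tendsto.mono_left ?_ nhdsWithin_le_nhds
    exact ((ENNReal.continuous_pow d).comp ENNReal.continuous_ofReal).tendsto r
  refine ge_of_tendsto ht ?_
  filter_upwards [self_mem_nhdsWithin] with s hs
  refine (measure_mono ?_).trans (hC β s (lt_of_le_of_lt hr hs))
  rintro p ⟨J, hJ, t, h0, h8, h⟩
  exact ⟨J, hJ, t, h0, h8, fun a ha => (h a ha).trans (le_of_lt hs)⟩

/-- the set of parameters for which the total weight vanishes somewhere on `F` -/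
def bad {ι : Type*} [Fintype ι] {X : Type*} [PseudoMetricSpace X]
    (d : ℕ) (b : ι → X → ℝ) (F : Set X) : Set (ι → ℝ) :=
  {p | (∀ a, 0 ≤ p a ∧ p a ≤ 1) ∧ ∃ q : ℝ, q ≤ 1 ∧ ∃ x ∈ F, DD d b p q x = 0}

lemma bad_le {ι : Type*} [Fintype ι] {X : Type*} [MetricSpace X] [MeasurableSpace X]
    [BorelSpace X] (d : ℕ) (b : ι → X → ℝ) (L : ℝ) (hL : 0 ≤ L)
    (hb : ∀ a x y, |b a x - b a y| ≤ L * dist x y) (hb8 : ∀ a x, b a x ≤ 8) :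
    ∃ C : ℝ≥0, ∀ (F : Set X) (m : ℝ≥0∞), μH[(d : ℝ)] F < m → cub ι (bad d b F) ≤ C * m := by
  obtain ⟨C, hC⟩ := Ev_le' (ι := ι) d
  refine ⟨C * (L.toNNReal) ^ d, fun F m hm => ?_⟩
  rw [Measure.hausdorffMeasure_apply] at hm
  have h1 := lt_of_le_of_lt (le_iSup₂ (α := ℝ≥0∞) 1 one_pos) hm
  simp only [iInf_lt_iff] at h1
  obtain ⟨T, hT, hT1, hsum⟩ := h1
  have hsub : bad d b F ⊆ ⋃ l, {p | ∃ x ∈ T l, (∀ a, 0 ≤ p a ∧ p a ≤ 1) ∧ ∃ q : ℝ, q ≤ 1 ∧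
      DD d b p q x = 0} := by
    rintro p ⟨hp, q, hq, x, hx, hD⟩
    obtain ⟨l, hl⟩ := mem_iUnion.1 (hT hx)
    exact mem_iUnion.2 ⟨l, x, hl, hp, q, hq, hD⟩
  have hl : ∀ l, cub ι {p | ∃ x ∈ T l, (∀ a, 0 ≤ p a ∧ p a ≤ 1) ∧ ∃ q : ℝ, q ≤ 1 ∧
      DD d b p q x = 0} ≤ (C * (L.toNNReal) ^ d : ℝ≥0) *
        (⨆ _ : (T l).Nonempty, ediam (T l) ^ (d : ℝ)) := by
    intro l
    rcases (T l).eq_empty_or_nonempty with he | ⟨y, hy⟩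
    · simp [he]
    have hne : (T l).Nonempty := ⟨y, hy⟩
    simp only [hne, iSup_pos]
    have hfin : ediam (T l) ≠ ⊤ := ((hT1 l).trans_lt ENNReal.one_lt_top).ne
    calc _ ≤ cub ι (Ev d (fun a => b a y) (L * (ediam (T l)).toReal)) := by
          refine measure_mono ?_
          rintro p ⟨x, hx, hp, q, hq, hD⟩
          obtain ⟨J, hJ, t, h0, h8, h⟩ := key d b p q x (fun a => hb8 a x) (fun a => (hp a).1)
            (fun a => (hp a).2) hq (by rw [hD]; exact one_pos)
          refine ⟨J, hJ, t, h0, h8, fun a ha => ?_⟩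
          have h2 := h a ha
          rw [hD] at h2
          have h3 : b a x - p a - t = 0 := abs_eq_zero.1 (le_antisymm h2 (abs_nonneg _))
          have : b a y - p a - t = b a y - b a x := by linarith
          rw [this]
          refine (hb a y x).trans ?_
          gcongr
          rw [dist_edist]
          exact ENNReal.toReal_mono hfin (edist_le_ediam_of_mem hy hx)
      _ ≤ C * ENNReal.ofReal (L * (ediam (T l)).toReal) ^ d := hC _ _ (by positivity)
      _ = _ := by
          rw [ENNReal.ofReal_mul hL, ENNReal.ofReal_toReal hfin, mul_pow, ENNReal.rpow_natCast,
            ENNReal.ofReal]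
          push_cast
          ring
  calc cub ι (bad d b F) ≤ _ := measure_mono hsub
    _ ≤ _ := measure_iUnion_le _
    _ ≤ ∑' l, (C * (L.toNNReal) ^ d : ℝ≥0) *
        (⨆ _ : (T l).Nonempty, ediam (T l) ^ (d : ℝ)) := ENNReal.tsum_le_tsum hl
    _ = (C * (L.toNNReal) ^ d : ℝ≥0) * _ := ENNReal.tsum_mul_left
    _ ≤ _ := by gcongr

/-- transition layers -/
def lay {ι : Type*} [Fintype ι] {X : Type*} [PseudoMetricSpace X]
    (d : ℕ) (b : ι → X → ℝ) (j : ℕ) : Set (X × ((ι → ℝ) × ℝ)) :=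
  {z | z.2.2 < bo b z.1 ∧ DD d b z.2.1 z.2.2 z.1 < (1 / 2) ^ j}

lemma cub_ae {ι : Type*} [Fintype ι] : ∀ᵐ p ∂(cub ι), ∀ a, 0 ≤ p a ∧ p a ≤ 1 := by
  rw [ae_all_iff]
  intro a
  have h : ∀ᵐ t ∂un, 0 ≤ t ∧ t ≤ 1 := ae_restrict_mem measurableSet_Icc
  exact (Measure.tendsto_eval_ae_ae (μ := fun _ : ι => un) (i := a)).eventually h

lemma cubq_ae {ι : Type*} [Fintype ι] : ∀ᵐ z ∂((cub ι).prod un),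
    (∀ a, 0 ≤ z.1 a ∧ z.1 a ≤ 1) ∧ 0 ≤ z.2 ∧ z.2 ≤ 1 := by
  have h : ∀ᵐ t ∂un, 0 ≤ t ∧ t ≤ 1 := ae_restrict_mem measurableSet_Icc
  have h1 := (Measure.quasiMeasurePreserving_fst (μ := cub ι) (ν := un)).ae cub_ae
  have h2 := (Measure.quasiMeasurePreserving_snd (μ := cub ι) (ν := un)).ae h
  filter_upwards [h1, h2] with z hz1 hz2 using ⟨hz1, hz2⟩

lemma lay_slice {ι : Type*} [Fintype ι] {X : Type*} [MetricSpace X]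
    (d : ℕ) (b : ι → X → ℝ) (hb8 : ∀ a x, b a x ≤ 8) :
    ∃ C : ℝ≥0, ∀ (j : ℕ) (x : X), ((cub ι).prod un) (Prod.mk x ⁻¹' lay d b j) ≤
      C * ((1 / 2) ^ j) ^ (d + 1) := by
  obtain ⟨C, hC⟩ := Ev_le' (ι := ι) d
  refine ⟨C * 2, fun j x => ?_⟩
  set r : ℝ := (1 / 2) ^ j with hr
  have hr0 : 0 < r := by positivity
  have hr1 : r ≤ 1 := pow_le_one₀ (by norm_num) (by norm_num)
  have hle : ((cub ι).prod un) (Prod.mk x ⁻¹' lay d b j) ≤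
      ((cub ι).prod un) (Ev d (fun a => b a x) r ×ˢ Icc (bo b x - r) (bo b x + r)) := by
    refine measure_mono_ae ?_
    filter_upwards [cubq_ae] with z hz hz'
    obtain ⟨hq, hD⟩ := hz'
    simp only at hq hD
    obtain ⟨J, hJ, t, h0, h8, h⟩ := key d b z.1 z.2 x (fun a => hb8 a x) (fun a => (hz.1 a).1)
            (fun a => (hz.1 a).2) hz.2.2 (hD.trans_le hr1)
    refine ⟨⟨J, hJ, t, h0, h8, fun a ha => (h a ha).trans hD.le⟩, ?_⟩
    have h0 : max 0 (bo b x - z.2) ≤ DD d b z.1 z.2 x :=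
      le_add_of_nonneg_left (sum_ww_nonneg d b z.1 x)
    have h1 := le_max_right 0 (bo b x - z.2)
    constructor <;> linarith
  refine hle.trans ?_
  rw [Measure.prod_prod]
  have h2 := un_Icc_le (bo b x - r) (bo b x + r)
  have h3 : bo b x + r - (bo b x - r) = 2 * r := by ring
  rw [h3, ENNReal.ofReal_mul (by norm_num)] at h2
  have h4 : ENNReal.ofReal r = (1 / 2) ^ j := by
    rw [hr, ENNReal.ofReal_pow (by norm_num), ENNReal.ofReal_div_of_pos (by norm_num)]
    simp
  calc _ ≤ (C * ENNReal.ofReal r ^ d) * (ENNReal.ofReal 2 * ENNReal.ofReal r) :=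
        mul_le_mul' (hC _ _ hr0.le) h2
    _ = _ := by
      rw [h4]
      simp
      ring

/-- total weighted layer mass -/
def tot {ι : Type*} [Fintype ι] {X : Type*} [MetricSpace X] [MeasurableSpace X]
    (d : ℕ) (b : ι → X → ℝ) (ν : Measure X) (z : (ι → ℝ) × ℝ) : ℝ≥0∞ :=
  ∑' j : ℕ, (2 ^ (j + 1)) ^ d * ν ((fun x => (x, z)) ⁻¹' lay d b j)

lemma tot_le {ι : Type*} [Fintype ι] {X : Type*} [MetricSpace X] [MeasurableSpace X]
    [BorelSpace X] [SecondCountableTopology X] (d : ℕ) (b : ι → X → ℝ)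
    (hbc : ∀ a, Continuous (b a)) (hb8 : ∀ a x, b a x ≤ 8) :
    ∃ C : ℝ≥0, ∀ (ν : Measure X) [IsFiniteMeasure ν],
      ∫⁻ z, tot d b ν z ∂((cub ι).prod un) ≤ C * ν univ := by
  obtain ⟨C, hC⟩ := lay_slice d b hb8
  refine ⟨C * 2 ^ d * 2, fun ν _ => ?_⟩
  have hmeas : ∀ j, MeasurableSet (lay d b j) := by
    intro j
    refine MeasurableSet.inter ?_ ?_
    · exact (isOpen_lt (by fun_prop) ((continuous_bo b hbc).comp continuous_fst)).measurableSet
    · exact (isOpen_lt (continuous_DD d b hbc) continuous_const).measurableSet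
  unfold tot
  rw [lintegral_tsum]
  swap
  · intro j
    exact ((measurable_measure_prodMk_right (hmeas j)).const_mul _).aemeasurable
  calc ∑' j : ℕ, ∫⁻ z, (2 ^ (j + 1)) ^ d * ν ((fun x => (x, z)) ⁻¹' lay d b j) ∂((cub ι).prod un)
      ≤ ∑' j : ℕ, (C * 2 ^ d * ν univ) * (1 / 2) ^ j := by
        refine ENNReal.tsum_le_tsum fun j => ?_
        rw [lintegral_const_mul _ (measurable_measure_prodMk_right (hmeas j)),
          ← Measure.prod_apply_symm (hmeas j), Measure.prod_apply (hmeas j)]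
        calc _ ≤ (2 ^ (j + 1)) ^ d * ∫⁻ x, C * ((1 / 2) ^ j) ^ (d + 1) ∂ν := by
              gcongr with x
              exact hC j x
          _ = _ := by
              rw [lintegral_const]
              have h2 : (2 : ℝ≥0∞) ^ j * (1 / 2) ^ j = 1 := by
                rw [← mul_pow, one_div, ENNReal.mul_inv_cancel (by norm_num) (by norm_num), one_pow]
              calc _ = C * 2 ^ d * ν univ * ((2 ^ j * (1 / 2) ^ j) ^ d * (1 / 2) ^ j) := by ring
                _ = _ := by rw [h2]; simp
    _ = _ := by
        rw [ENNReal.tsum_mul_left]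
        simp only [one_div]
        rw [ENNReal.tsum_geometric_two]
        push_cast
        ring

lemma choose_p {ι : Type*} [Fintype ι] {X : Type*} [MetricSpace X] [MeasurableSpace X]
    [BorelSpace X] [SecondCountableTopology X] (d : ℕ) (b : ι → X → ℝ) (L : ℝ) (hL : 0 ≤ L)
    (hb : ∀ a x y, |b a x - b a y| ≤ L * dist x y) (hb8 : ∀ a x, b a x ≤ 8)
    (hbc : ∀ a, Continuous (b a)) (ε : ℝ≥0) (hε : 0 < ε) :
    ∃ δ : ℝ≥0, 0 < δ ∧ ∀ F : Set X, MeasurableSet F → μH[(d : ℝ)] F < δ →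
      ∃ (p : ι → ℝ) (q : ℝ), (∀ a, 0 ≤ p a ∧ p a ≤ 1) ∧ 0 ≤ q ∧ q ≤ 1 ∧
        (∀ x ∈ F, 0 < DD d b p q x) ∧
        ∑' j : ℕ, (2 ^ (j + 1)) ^ d * μH[(d : ℝ)]
          ({x | q < bo b x ∧ DD d b p q x < (1 / 2) ^ j} ∩ F) < (ε : ℝ≥0∞) := by
  obtain ⟨C1, hC1⟩ := bad_le d b L hL hb hb8
  obtain ⟨C2, hC2⟩ := tot_le d b hbc hb8
  refine ⟨min (1 / (4 * (C1 + 1))) (ε / (4 * (C2 + 1))), by positivity, fun F hF hFδ => ?_⟩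
  set δ := min (1 / (4 * (C1 + 1))) (ε / (4 * (C2 + 1))) with hδ
  have h1 : C1 * δ ≤ 1 / 4 := by
    calc C1 * δ ≤ (C1 + 1) * (1 / (4 * (C1 + 1))) := by
          gcongr
          · exact le_self_add
          · exact min_le_left _ _
      _ = 1 / 4 := by field_simp
  have h2 : C2 * δ ≤ ε * (1 / 4) := by
    calc C2 * δ ≤ (C2 + 1) * (ε / (4 * (C2 + 1))) := by
          gcongr
          · exact le_self_add
          · exact min_le_right _ _
      _ = ε * (1 / 4) := by field_simp
  set ν := (μH[(d : ℝ)] : Measure X).restrict F with hν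
  have hνu : ν univ = μH[(d : ℝ)] F := by simp [hν]
  have : IsFiniteMeasure ν := ⟨by rw [hνu]; exact hFδ.trans ENNReal.coe_lt_top⟩
  have hB : ((cub ι).prod un) (bad d b F ×ˢ univ) ≤ 1 / 4 := by
    rw [Measure.prod_prod, measure_univ, mul_one]
    refine (hC1 F δ hFδ).trans ?_
    have : ((C1 * δ : ℝ≥0) : ℝ≥0∞) ≤ ((1 / 4 : ℝ≥0) : ℝ≥0∞) := by exact_mod_cast h1
    refine le_trans (by push_cast; exact le_rfl) (this.trans ?_)
    rw [ENNReal.coe_div (by norm_num)]; simp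
  have hM : ((cub ι).prod un) {z | (ε : ℝ≥0∞) ≤ tot d b ν z} ≤ 1 / 4 := by
    have hmk := mul_meas_ge_le_lintegral₀ (μ := (cub ι).prod un) (f := tot d b ν) ?_ ε
    · have : (ε : ℝ≥0∞) * ((cub ι).prod un) {z | (ε : ℝ≥0∞) ≤ tot d b ν z} ≤ ε * (1 / 4) := by
        refine hmk.trans ((hC2 ν).trans ?_)
        rw [hνu]
        calc (C2 : ℝ≥0∞) * μH[(d : ℝ)] F ≤ C2 * δ := by gcongr
          _ ≤ ((ε * (1 / 4) : ℝ≥0) : ℝ≥0∞) := by exact_mod_cast h2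
          _ = _ := by
            rw [ENNReal.coe_mul, ENNReal.coe_div (by norm_num)]; simp
      exact (ENNReal.mul_le_mul_iff_right (by exact_mod_cast hε.ne') ENNReal.coe_ne_top).1 this
    · unfold tot
      refine (Measurable.tsum fun j => ?_).aemeasurable
      refine (measurable_measure_prodMk_right ?_).const_mul _
      refine MeasurableSet.inter ?_ ?_
      · exact (isOpen_lt (by fun_prop) ((continuous_bo b hbc).comp continuous_fst)).measurableSet
      · exact (isOpen_lt (continuous_DD d b hbc) continuous_const).measurableSet
  have hN : ((cub ι).prod un) {z | ¬ ((∀ a, 0 ≤ z.1 a ∧ z.1 a ≤ 1) ∧ 0 ≤ z.2 ∧ z.2 ≤ 1)} = 0 :=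
    cubq_ae
  have hex : ∃ z, z ∉ (bad d b F ×ˢ univ) ∪ {z | (ε : ℝ≥0∞) ≤ tot d b ν z} ∪
      {z | ¬ ((∀ a, 0 ≤ z.1 a ∧ z.1 a ≤ 1) ∧ 0 ≤ z.2 ∧ z.2 ≤ 1)} := by
    by_contra hcon
    rw [not_exists] at hcon
    have hu : (bad d b F ×ˢ univ) ∪ {z | (ε : ℝ≥0∞) ≤ tot d b ν z} ∪
      {z | ¬ ((∀ a, 0 ≤ z.1 a ∧ z.1 a ≤ 1) ∧ 0 ≤ z.2 ∧ z.2 ≤ 1)} = univ :=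
      eq_univ_of_forall (fun z => not_not.1 (hcon z))
    have h3 : (1 : ℝ≥0∞) ≤ 1 / 4 + 1 / 4 := by
      calc (1 : ℝ≥0∞) = ((cub ι).prod un) univ := measure_univ.symm
        _ ≤ _ := by
          rw [← hu]
          refine (measure_union_le _ _).trans ?_
          rw [hN, add_zero]
          exact (measure_union_le _ _).trans (add_le_add hB hM)
    have h4 := ENNReal.toReal_mono (by simp) h3
    rw [ENNReal.toReal_add (by simp) (by simp)] at h4
    norm_num at h4
  obtain ⟨⟨p, q⟩, hz⟩ := hex
  simp only [mem_union, mem_prod, mem_univ, and_true, mem_ofPred_eq, not_or, not_not, not_le] at hz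
  obtain ⟨⟨hz1, hz2⟩, hz3, hz4, hz5⟩ := hz
  refine ⟨p, q, hz3, hz4, hz5, fun x hx => ?_, ?_⟩
  · rcases (DD_nonneg d b p q x).lt_or_eq with h | h
    · exact h
    · exact absurd ⟨hz3, q, hz5, x, hx, h.symm⟩ hz1
  · refine lt_of_eq_of_lt ?_ hz2
    unfold tot
    refine tsum_congr fun j => ?_
    rw [hν, Measure.restrict_apply' hF]
    rfl


lemma hull_null (n d : ℕ) (hd : 1 ≤ d) (J : Finset (Euc n)) (hJ : J.card ≤ d) :
    μH[(d : ℝ)] (convexHull ℝ (J : Set (Euc n))) = 0 := by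
  classical
  rcases J.eq_empty_or_nonempty with rfl | ⟨v0, hv0⟩
  · simp
  let f : (↥(J.erase v0) → ℝ) → Euc n := fun t => v0 + ∑ i, t i • ((i : Euc n) - v0)
  have hf : ContDiff ℝ 1 f := by
    unfold f
    fun_prop
  have hsub : convexHull ℝ (J : Set (Euc n)) ⊆ range f := by
    intro y hy
    rw [Finset.mem_convexHull'] at hy
    obtain ⟨w, -, hw1, hwy⟩ := hy
    refine ⟨fun i => w i, ?_⟩
    simp only [f]
    rw [Finset.sum_coe_sort (J.erase v0) (fun i => w i • (i - v0))]
    have h1 : ∑ i ∈ J, w i • (i - v0) = ∑ i ∈ J.erase v0, w i • (i - v0) := by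
      rw [← Finset.add_sum_erase J _ hv0]; simp
    rw [← h1]
    simp only [smul_sub, Finset.sum_sub_distrib]
    rw [← Finset.sum_smul, hw1, hwy]
    simp
  refine measure_mono_null hsub ?_
  have hdim : dimH (range f) < ((d : ℝ≥0) : ℝ≥0∞) := by
    refine (hf.dimH_range_le).trans_lt ?_
    rw [Module.finrank_fintype_fun_eq_card, Fintype.card_coe, Finset.card_erase_of_mem hv0]
    have : 0 < J.card := Finset.card_pos.2 ⟨v0, hv0⟩
    have : J.card - 1 < d := by omega
    exact_mod_cast this
  have := hausdorffMeasure_of_dimH_lt hdim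
  simpa using this

section
variable {ι : Type*} [Fintype ι] {n : ℕ}

/-- bump functions -/
def bmp (v : ι → Euc n) (ρ : ι → ℝ) (a : ι) (x : Euc n) : ℝ := max 0 (8 - 8 / ρ a * dist x (v a))

/-- the deformation -/
def phi (d : ℕ) (v : ι → Euc n) (ρ : ι → ℝ) (p : ι → ℝ) (q δ : ℝ) (x : Euc n) : Euc n :=
  x + (max (DD d (bmp v ρ) p q x) δ)⁻¹ • ∑ a, ww d (bmp v ρ) p x a • (v a - x)

variable (d : ℕ) (v : ι → Euc n) (ρ : ι → ℝ)

lemma bmp_le (hρ : ∀ a, 0 < ρ a)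
    (a : ι) (x : Euc n) : bmp v ρ a x ≤ 8 := by
  have := hρ a
  have : 0 ≤ 8 / ρ a * dist x (v a) := by positivity
  exact max_le (by norm_num) (by linarith)

lemma bmp_pos (hρ : ∀ a, 0 < ρ a)
    (a : ι) (x : Euc n) (h : 0 < bmp v ρ a x) : dist x (v a) < ρ a := by
  have h0 := hρ a
  unfold bmp at h
  rw [lt_max_iff] at h
  rcases h with h | h
  · exact absurd h (lt_irrefl _)
  · have : 8 / ρ a * dist x (v a) < 8 := by linarith
    rw [div_mul_eq_mul_div, div_lt_iff₀ h0] at this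
    linarith

lemma bmp_ge (hρ : ∀ a, 0 < ρ a)
    (a : ι) (x : Euc n) (h : dist x (v a) ≤ ρ a / 2) : 4 ≤ bmp v ρ a x := by
  have h0 := hρ a
  refine le_max_of_le_right ?_
  have : 8 / ρ a * dist x (v a) ≤ 8 / ρ a * (ρ a / 2) := by gcongr
  have h2 : 8 / ρ a * (ρ a / 2) = 4 := by field_simp; norm_num
  linarith

lemma bmp_lip (hρ : ∀ a, 0 < ρ a)
    (a : ι) (x y : Euc n) :
    |bmp v ρ a x - bmp v ρ a y| ≤ (∑ a, 8 / ρ a) * dist x y := by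
  refine (abs_max_sub _ _).trans ?_
  have h0 : 0 < 8 / ρ a := div_pos (by norm_num) (hρ a)
  have h1 : 8 / ρ a ≤ ∑ a, 8 / ρ a :=
    Finset.single_le_sum (f := fun a => 8 / ρ a)
      (fun a _ => (div_pos (by norm_num) (hρ a)).le) (Finset.mem_univ a)
  calc |8 - 8 / ρ a * dist x (v a) - (8 - 8 / ρ a * dist y (v a))|
      = 8 / ρ a * |dist x (v a) - dist y (v a)| := by
        rw [← abs_of_pos h0, ← abs_mul, abs_sub_comm, abs_of_pos h0]; congr 1; ring
    _ ≤ 8 / ρ a * dist x y := by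
        gcongr
        exact abs_dist_sub_le _ _ _
    _ ≤ _ := by gcongr

lemma ww_norm_le (hρ : ∀ a, 0 < ρ a)
    (p : ι → ℝ) (hp : ∀ a, 0 ≤ p a) (x : Euc n) (R : ℝ)
    (hR : ∀ a, dist x (v a) < ρ a → ρ a ≤ R) (q : ℝ) (hR0 : 0 ≤ R) :
    ‖∑ a, ww d (bmp v ρ) p x a • (v a - x)‖ ≤ DD d (bmp v ρ) p q x * R := by
  calc ‖∑ a, ww d (bmp v ρ) p x a • (v a - x)‖
      ≤ ∑ a, ww d (bmp v ρ) p x a * R := by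
        refine norm_sum_le_of_le _ fun a _ => ?_
        rw [norm_smul, Real.norm_of_nonneg (ww_nonneg _ _ _ _ _)]
        rcases (ww_nonneg d (bmp v ρ) p x a).lt_or_eq with h | h
        · have h1 := bmp_pos v ρ hρ a x (ww_pos d _ p x a hp h)
          gcongr
          rw [← dist_eq_norm, dist_comm]
          exact h1.le.trans (hR a h1)
        · simp [← h]
    _ = (∑ a, ww d (bmp v ρ) p x a) * R := (Finset.sum_mul _ _ _).symm
    _ ≤ _ := by
        gcongr
        exact sum_ww_le _ _ _ _ _

lemma phi_lip (hρ : ∀ a, 0 < ρ a) : ∃ C : ℝ≥0, ∀ (p : ι → ℝ) (q δ : ℝ), (∀ a, 0 ≤ p a) → 0 ≤ q → 0 < δ → δ ≤ 1 →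
    ∀ x y, dist (phi d v ρ p q δ x) (phi d v ρ p q δ y) ≤
      C / max (DD d (bmp v ρ) p q x) δ * dist x y := by
  set L := ∑ a, 8 / ρ a with hLdef
  set R := ∑ a, ρ a with hRdef
  have hL : 0 ≤ L := Finset.sum_nonneg fun a _ => (div_pos (by norm_num) (hρ a)).le
  have hR : 0 ≤ R := Finset.sum_nonneg fun a _ => (hρ a).le
  have hRa : ∀ a, ρ a ≤ R := fun a =>
    Finset.single_le_sum (f := ρ) (fun a _ => (hρ a).le) (Finset.mem_univ a)
  set N : ℝ := ((Fintype.card ι : ℕ) : ℝ) with hN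
  have hN0 : 0 ≤ N := by positivity
  set C : ℝ := (8 * N + 4) + N * (2 * L * R + 8) + R * ((2 * N + 1) * L) with hC
  have hC0 : 0 ≤ C := by positivity
  refine ⟨⟨C, hC0⟩, fun p q δ hp hq hδ hδ1 x y => ?_⟩
  change _ ≤ C / _ * _
  set b := bmp v ρ with hb
  set G : Euc n → Euc n := fun x => ∑ a, ww d b p x a • (v a - x) with hG
  set M : Euc n → ℝ := fun x => max (DD d b p q x) δ with hM
  have hMpos : ∀ x, 0 < M x := fun x => lt_max_of_lt_right hδ
  have hMle : ∀ x, M x ≤ 8 * N + 4 := fun x =>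
    max_le (DD_le d b p q x (fun a => bmp_le v ρ hρ a x) hp hq) (by linarith)
  have hMlip : |M y - M x| ≤ (2 * N + 1) * L * dist x y := by
    have h1 := abs_max_sub_max_le_abs (DD d b p q y) (DD d b p q x) δ
    have h2 := DD_lip d b p q L hL (fun a x y => bmp_lip v ρ hρ a x y) y x
    rw [dist_comm y x] at h2
    exact h1.trans h2
  have hGle : ‖G y‖ ≤ M y * R := by
    refine (ww_norm_le d v ρ hρ p hp y R (fun a _ => hRa a) q hR).trans ?_
    gcongr
    exact le_max_left _ _
  have hGlip : ‖G x - G y‖ ≤ N * (2 * L * R + 8) * dist x y := by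
    simp only [hG]
    rw [← Finset.sum_sub_distrib]
    have hterm : ∀ a, ‖ww d b p x a • (v a - x) - ww d b p y a • (v a - y)‖ ≤
        (2 * L * R + 8) * dist x y := by
      intro a
      have h1 := ww_lip d b p L hL (fun a x y => bmp_lip v ρ hρ a x y) x y a
      rcases (ww_nonneg d b p x a).lt_or_eq with h | h
      · have h2 := bmp_pos v ρ hρ a x (ww_pos d _ p x a hp h)
        have h3 := ww_le d b p y (fun a => bmp_le v ρ hρ a y) hp a
        have h4 : ww d b p x a • (v a - x) - ww d b p y a • (v a - y) =
            (ww d b p x a - ww d b p y a) • (v a - x) + ww d b p y a • (y - x) := by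
          module
        rw [h4]
        refine (norm_add_le _ _).trans ?_
        rw [norm_smul, norm_smul, Real.norm_eq_abs, Real.norm_of_nonneg (ww_nonneg _ _ _ _ _),
          ← dist_eq_norm, ← dist_eq_norm, dist_comm y x, dist_comm _ x]
        calc _ ≤ (2 * L * dist x y) * R + 8 * dist x y := by
              gcongr
              exact h2.le.trans (hRa a)
          _ = _ := by ring
      · rcases (ww_nonneg d b p y a).lt_or_eq with h' | h'
        · have h2 := bmp_pos v ρ hρ a y (ww_pos d _ p y a hp h')
          have h4 : ww d b p x a • (v a - x) - ww d b p y a • (v a - y) =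
              (ww d b p x a - ww d b p y a) • (v a - y) := by
            rw [← h]; module
          rw [h4, norm_smul, Real.norm_eq_abs, ← dist_eq_norm, dist_comm _ y]
          calc _ ≤ (2 * L * dist x y) * R := by
                gcongr
                exact h2.le.trans (hRa a)
            _ ≤ _ := by nlinarith [dist_nonneg (x := x) (y := y)]
        · rw [← h, ← h']
          simp only [zero_smul, sub_zero, norm_zero]
          positivity
    refine (norm_sum_le_of_le _ fun a _ => hterm a).trans ?_
    rw [Finset.sum_const, nsmul_eq_mul, Finset.card_univ]
    exact le_of_eq (by ring)
  have hx := hMpos x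
  have hy := hMpos y
  have heq : phi d v ρ p q δ x - phi d v ρ p q δ y =
      (x - y) + ((M x)⁻¹ • (G x - G y) + ((M x)⁻¹ * (M y - M x) * (M y)⁻¹) • G y) := by
    have h5 : (M x)⁻¹ * (M y - M x) * (M y)⁻¹ = (M x)⁻¹ - (M y)⁻¹ := by
      field_simp
    rw [h5]
    change (x + (M x)⁻¹ • G x) - (y + (M y)⁻¹ • G y) = _
    module
  rw [dist_eq_norm (phi d v ρ p q δ x), heq]
  have e1 : ‖x - y‖ ≤ (8 * N + 4) * (M x)⁻¹ * dist x y := by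
    rw [← dist_eq_norm]
    have : 1 ≤ (8 * N + 4) * (M x)⁻¹ := by
      rw [← div_eq_mul_inv, le_div_iff₀ hx]; linarith [hMle x]
    nlinarith [dist_nonneg (x := x) (y := y)]
  have e2 : ‖(M x)⁻¹ • (G x - G y)‖ ≤ (M x)⁻¹ * (N * (2 * L * R + 8) * dist x y) := by
    rw [norm_smul, Real.norm_of_nonneg (by positivity)]
    gcongr
  have e3 : ‖((M x)⁻¹ * (M y - M x) * (M y)⁻¹) • G y‖ ≤
      (M x)⁻¹ * ((2 * N + 1) * L * dist x y) * R := by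
    rw [norm_smul, Real.norm_eq_abs, abs_mul, abs_mul, abs_of_pos (inv_pos.2 hx),
      abs_of_pos (inv_pos.2 hy)]
    calc _ ≤ (M x)⁻¹ * ((2 * N + 1) * L * dist x y) * (M y)⁻¹ * (M y * R) := by gcongr
      _ = _ := by field_simp
  calc _ ≤ _ := (norm_add_le _ _).trans (add_le_add e1 ((norm_add_le _ _).trans (add_le_add e2 e3)))
    _ = _ := by
      rw [hC, div_eq_mul_inv]; ring

end

lemma bmp_cont {ι : Type*} {n : ℕ} (v : ι → Euc n) (ρ : ι → ℝ) (a : ι) :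
    Continuous (bmp v ρ a) := by
  unfold bmp; fun_prop

lemma cont_DD' {ι : Type*} [Fintype ι] {n : ℕ} (d : ℕ) (b : ι → Euc n → ℝ) (p : ι → ℝ) (q : ℝ)
    (hb : ∀ a, Continuous (b a)) : Continuous (DD d b p q) := by
  have h1 : Continuous (fun x : Euc n => (x, (p, q))) := by fun_prop
  have h2 := continuous_DD d b hb
  exact h2.comp h1

set_option maxHeartbeats 400000 in
lemma stage (n d : ℕ) (hd : 1 ≤ d) (I : Finset (Euc n)) (ρ : Euc n → ℝ) (hρ : ∀ v ∈ I, 0 < ρ v)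
    (ε : ℝ≥0) (hε : 0 < ε) :
    ∃ δ : ℝ≥0, 0 < δ ∧ ∀ F : Set (Euc n), IsCompact F → μH[(d : ℝ)] F < δ →
      ∃ φ : Euc n → Euc n, (∃ K : ℝ≥0, LipschitzWith K φ) ∧
        (∀ x, φ x ≠ x → ∃ v ∈ I, dist x v < ρ v ∧ dist (φ x) x ≤ ρ v) ∧
        μH[(d : ℝ)] (φ '' F) ≤ ε ∧
        (∀ x ∈ F, (∃ v ∈ I, dist x v ≤ ρ v / 2) → ∃ J : Finset (Euc n), J ⊆ I ∧ J.card ≤ d ∧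
          (∀ v ∈ J, dist x v < ρ v) ∧ φ x ∈ convexHull ℝ (J : Set (Euc n))) := by
  classical
  let v : I → Euc n := fun a => a
  let ρ' : I → ℝ := fun a => ρ a
  have hρ' : ∀ a, 0 < ρ' a := fun a => hρ a a.2
  set b := bmp v ρ' with hb
  obtain ⟨C, hC⟩ := phi_lip d v ρ' hρ'
  have hL : 0 ≤ ∑ a, 8 / ρ' a := Finset.sum_nonneg fun a _ => (div_pos (by norm_num) (hρ' a)).le
  set ε' : ℝ≥0 := ε / (2 * (C ^ d + 1)) with hε'
  have hε'0 : 0 < ε' := by positivity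
  have hbc : ∀ a, Continuous (b a) := bmp_cont v ρ'
  obtain ⟨δ0, hδ0, hch⟩ := choose_p d b _ hL (fun a x y => bmp_lip v ρ' hρ' a x y)
    (fun a x => bmp_le v ρ' hρ' a x) hbc ε' hε'0
  refine ⟨min δ0 ε', by positivity, fun F hF hFδ => ?_⟩
  obtain ⟨p, q, hp, hq0, hq1, hDpos, hsum⟩ := hch F hF.measurableSet
    (hFδ.trans_le (by exact_mod_cast min_le_left _ _))
  have hp0 : ∀ a, 0 ≤ p a := fun a => (hp a).1
  have hDcont : Continuous (DD d b p q) := cont_DD' d b p q hbc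
  obtain ⟨δ, hδ, hδ1, hδD⟩ : ∃ δ : ℝ, 0 < δ ∧ δ ≤ 1 ∧ ∀ x ∈ F, δ ≤ DD d b p q x := by
    rcases F.eq_empty_or_nonempty with rfl | hne
    · exact ⟨1, one_pos, le_rfl, by simp⟩
    · obtain ⟨x0, hx0, hmin⟩ := hF.exists_isMinOn hne hDcont.continuousOn
      exact ⟨min 1 (DD d b p q x0), lt_min one_pos (hDpos x0 hx0), min_le_left _ _,
        fun x hx => (min_le_right _ _).trans (hmin hx)⟩
  have hlip := hC p q δ hp0 hq0 hδ hδ1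
  set φ := phi d v ρ' p q δ with hφ
  -- points where the outer weight vanishes
  have hin : ∀ x ∈ F, bo b x ≤ q → ∃ J : Finset (Euc n), J ⊆ I ∧ J.card ≤ d ∧
          (∀ v ∈ J, dist x v < ρ v) ∧ φ x ∈ convexHull ℝ (J : Set (Euc n)) := by
    intro x hx hbo
    let J : Finset I := Finset.univ.filter (fun a => 0 < ww d b p x a)
    have hDx : DD d b p q x = ∑ a, ww d b p x a := by
      unfold DD
      rw [max_eq_left (by linarith), add_zero]
    have hsumJ : ∀ f : I → Euc n, ∑ a, ww d b p x a • f a = ∑ a ∈ J, ww d b p x a • f a := by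
      intro f
      rw [Finset.sum_filter]
      refine Finset.sum_congr rfl fun a _ => ?_
      rcases (ww_nonneg d b p x a).lt_or_eq with h | h
      · simp [h]
      · simp [← h]
    have hsumJ' : ∑ a, ww d b p x a = ∑ a ∈ J, ww d b p x a := by
      rw [Finset.sum_filter]
      refine Finset.sum_congr rfl fun a _ => ?_
      rcases (ww_nonneg d b p x a).lt_or_eq with h | h
      · simp [h]
      · simp [← h]
    have hD0 := hDpos x hx
    refine ⟨J.map (Function.Embedding.subtype _), ?_, ?_, ?_, ?_⟩
    · intro y hy
      rw [Finset.mem_map] at hy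
      obtain ⟨a, -, rfl⟩ := hy
      exact a.2
    · rw [Finset.card_map]
      exact card_ww d b p x J (fun a ha => (Finset.mem_filter.1 ha).2)
    · intro y hy
      rw [Finset.mem_map] at hy
      obtain ⟨a, ha, rfl⟩ := hy
      exact bmp_pos v ρ' hρ' a x (ww_pos d _ p x a hp0 (Finset.mem_filter.1 ha).2)
    · have h1 : φ x = J.centerMass (fun a => ww d b p x a) v := by
        have h2 : φ x = x + (DD d b p q x)⁻¹ • ∑ a, ww d b p x a • (v a - x) := by
          simp only [hφ, phi]
          rw [max_eq_left (hδD x hx)]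
        rw [h2, Finset.centerMass, ← hsumJ', ← hDx, ← hsumJ]
        simp only [smul_sub, Finset.sum_sub_distrib]
        rw [← Finset.sum_smul, ← hDx, smul_smul, inv_mul_cancel₀ hD0.ne']
        simp
      rw [h1]
      refine Finset.centerMass_mem_convexHull J (fun a _ => ww_nonneg _ _ _ _ _) ?_ ?_
      · rw [← hsumJ', ← hDx]; exact hD0
      · intro a ha
        simp only [Finset.coe_map, Set.mem_image]
        exact ⟨a, ha, rfl⟩
  refine ⟨φ, ⟨C / δ.toNNReal, ?_⟩, ?_, ?_, ?_⟩
  · refine LipschitzWith.of_dist_le_mul fun x y => ?_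
    refine (hlip x y).trans ?_
    push_cast
    rw [Real.coe_toNNReal _ hδ.le]
    gcongr
    exact le_max_right _ _
  · intro x hx
    let A : Finset I := Finset.univ.filter (fun a => dist x (v a) < ρ' a)
    have hA : A.Nonempty := by
      by_contra hne
      apply hx
      rw [Finset.not_nonempty_iff_eq_empty] at hne
      have h0 : ∀ a, ww d b p x a = 0 := by
        intro a
        by_contra h
        have h1 := bmp_pos v ρ' hρ' a x (ww_pos d _ p x a hp0
          (lt_of_le_of_ne (ww_nonneg _ _ _ _ _) (Ne.symm h)))
        have : a ∈ A := by simp [A, h1]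
        rw [hne] at this
        simp at this
      simp only [hφ, phi]
      rw [← hb]
      simp [h0]
    obtain ⟨a, ha, hmax⟩ := Finset.exists_max_image A ρ' hA
    refine ⟨a, a.2, (Finset.mem_filter.1 ha).2, ?_⟩
    have h1 := ww_norm_le d v ρ' hρ' p hp0 x (ρ' a)
      (fun a' h => hmax a' (by simp [A, h])) q (hρ' a).le
    rw [dist_eq_norm]
    simp only [hφ, phi, add_sub_cancel_left]
    have hM : 0 < max (DD d (bmp v ρ') p q x) δ := lt_max_of_lt_right hδ
    rw [norm_smul, Real.norm_of_nonneg (inv_pos.2 hM).le, inv_mul_le_iff₀ hM]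
    refine h1.trans ?_
    have := (hρ' a).le
    change _ ≤ _ * ρ' a
    gcongr
    exact le_max_left _ _
  · -- measure estimate
    have hlipA : ∀ (A : Set (Euc n)) (m : ℕ), (∀ x ∈ A, (1 / 2) ^ m ≤ DD d b p q x) →
        μH[(d : ℝ)] (φ '' A) ≤ (C : ℝ≥0∞) ^ d * ((2 ^ m) ^ d * μH[(d : ℝ)] A) := by
      intro A m hA
      have : LipschitzOnWith (C * 2 ^ m) φ A := by
        refine LipschitzOnWith.of_dist_le_mul fun x hx y _ => ?_
        refine (hlip x y).trans ?_
        push_cast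
        gcongr
        have h1 : (1 / 2 : ℝ) ^ m ≤ max (DD d b p q x) δ := (hA x hx).trans (le_max_left _ _)
        calc (C : ℝ) / max (DD d b p q x) δ ≤ C / (1 / 2) ^ m := by gcongr
          _ = _ := by simp
      refine (this.hausdorffMeasure_image_le (Nat.cast_nonneg d)).trans (le_of_eq ?_)
      rw [ENNReal.rpow_natCast]
      push_cast
      ring
    let P : Set (Euc n) := ⋃ J ∈ I.powerset.filter (fun J => J.card ≤ d),
      convexHull ℝ (J : Set (Euc n))
    have hP : μH[(d : ℝ)] P = 0 := by
      refine (measure_biUnion_null_iff (Finset.countable_toSet _)).2 fun J hJ => ?_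
      exact hull_null n d hd J (Finset.mem_filter.1 hJ).2
    let A0 : Set (Euc n) := {x | 1 ≤ DD d b p q x} ∩ F
    let A : ℕ → Set (Euc n) := fun j =>
      {x | (1 / 2) ^ (j + 1) ≤ DD d b p q x} ∩
        ({x | q < bo b x ∧ DD d b p q x < (1 / 2) ^ j} ∩ F)
    have hcov : φ '' F ⊆ P ∪ (φ '' A0 ∪ ⋃ j, φ '' A j) := by
      rintro _ ⟨x, hx, rfl⟩
      rcases le_or_gt (bo b x) q with hbo | hbo
      · left
        obtain ⟨J, hJ1, hJ2, -, hJ⟩ := hin x hx hbo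
        exact mem_biUnion (by simp [hJ1, hJ2]) hJ
      · right
        rcases le_or_gt 1 (DD d b p q x) with hD | hD
        · left; exact ⟨x, ⟨hD, hx⟩, rfl⟩
        · right
          have hex : ∃ m : ℕ, (1 / 2 : ℝ) ^ m ≤ DD d b p q x := by
            obtain ⟨m, hm⟩ := exists_pow_lt_of_lt_one (hDpos x hx) (show (1 / 2 : ℝ) < 1 by norm_num)
            exact ⟨m, hm.le⟩
          obtain ⟨j, hj⟩ : ∃ j, Nat.find hex = j + 1 := by
            refine Nat.exists_eq_succ_of_ne_zero fun h0 => ?_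
            have := Nat.find_spec hex
            rw [h0, pow_zero] at this
            linarith
          have hj1 : (1 / 2 : ℝ) ^ (j + 1) ≤ DD d b p q x := hj ▸ Nat.find_spec hex
          have hj2 : DD d b p q x < (1 / 2 : ℝ) ^ j :=
            not_le.1 (Nat.find_min hex (show j < Nat.find hex by omega))
          exact mem_iUnion.2 ⟨j, x, ⟨hj1, ⟨hbo, hj2⟩, hx⟩, rfl⟩
    calc μH[(d : ℝ)] (φ '' F) ≤ _ := measure_mono hcov
      _ ≤ 0 + (μH[(d : ℝ)] (φ '' A0) + ∑' j, μH[(d : ℝ)] (φ '' A j)) := by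
        refine (measure_union_le _ _).trans (add_le_add hP.le ?_)
        exact (measure_union_le _ _).trans (add_le_add le_rfl (measure_iUnion_le _))
      _ ≤ 0 + (C ^ d * ε' + C ^ d * ε') := by
        gcongr
        · refine (hlipA A0 0 (fun x hx => by simpa using hx.1)).trans ?_
          gcongr
          simp only [pow_zero, one_pow, one_mul]
          refine (measure_mono inter_subset_right).trans (hFδ.le.trans ?_)
          exact_mod_cast min_le_right _ _
        · calc ∑' j, μH[(d : ℝ)] (φ '' A j) ≤ ∑' j : ℕ, (C : ℝ≥0∞) ^ d * ((2 ^ (j + 1)) ^ d * μH[(d : ℝ)]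
              ({x | q < bo b x ∧ DD d b p q x < (1 / 2) ^ j} ∩ F)) := by
                refine ENNReal.tsum_le_tsum fun j => ?_
                refine (hlipA (A j) (j + 1) (fun x hx => hx.1)).trans ?_
                gcongr
                exact inter_subset_right
            _ = C ^ d * _ := ENNReal.tsum_mul_left
            _ ≤ _ := by gcongr
      _ ≤ ε := by
        have : C ^ d * ε' + C ^ d * ε' ≤ ε := by
          calc C ^ d * ε' + C ^ d * ε' = 2 * C ^ d * ε' := by ring
            _ ≤ 2 * (C ^ d + 1) * ε' := by gcongr; exact le_self_add
            _ = ε := by rw [hε']; field_simp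
        rw [zero_add]
        exact_mod_cast this
  · rintro x hx ⟨w, hw, hdist⟩
    refine hin x hx ?_
    have h1 := bmp_ge v ρ' hρ' ⟨w, hw⟩ x hdist
    have h2 := le_lam_zero (fun a => b a x) ⟨w, hw⟩
    have : bo b x = 0 := max_eq_left (by linarith)
    rw [this]; exact hq0


lemma exists_cover (n : ℕ) (V : Set (Euc n)) (hVo : IsOpen V) (hVb : Bornology.IsBounded V)
    (hVc : (Vᶜ).Nonempty) (τ : ℝ) (hτ : 0 < τ) :
    ∃ t : ℕ → Finset (Euc n),
      (∀ m, ∀ v ∈ t m, 0 < infDist v Vᶜ ∧ infDist v Vᶜ * m ≤ 1) ∧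
      (∀ (i : ℕ) (x : Euc n), 1 / ((i : ℝ) + 1) ≤ infDist x Vᶜ →
        ∃ m ≤ i, ∃ v ∈ t m, dist x v ≤ min τ (infDist v Vᶜ / 2) / 2) := by
  classical
  let S : ℕ → Set (Euc n) := fun m => {x | 1 / ((m : ℝ) + 1) ≤ infDist x Vᶜ ∧ infDist x Vᶜ * m ≤ 1}
  have hpos : ∀ m, ∀ x ∈ S m, 0 < infDist x Vᶜ := fun m x hx =>
    lt_of_lt_of_le (by positivity) hx.1
  have hScl : ∀ m, IsClosed (S m) := fun m =>
    (isClosed_le continuous_const (continuous_infDist_pt _)).inter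
      (isClosed_le ((continuous_infDist_pt _).mul continuous_const) continuous_const)
  have hSV : ∀ m, S m ⊆ V := by
    intro m x hx
    by_contra hxV
    have : infDist x Vᶜ = 0 := infDist_zero_of_mem hxV
    linarith [hpos m x hx]
  have hSc : ∀ m, IsCompact (S m) := fun m =>
    isCompact_of_isClosed_isBounded (hScl m) (hVb.subset (hSV m))
  have hex : ∀ m, ∃ t : Finset (Euc n), (∀ x ∈ t, x ∈ S m) ∧
      S m ⊆ ⋃ x ∈ t, ball x (min τ (infDist x Vᶜ / 2) / 2) := fun m =>
    (hSc m).elim_nhds_subcover (fun x => ball x (min τ (infDist x Vᶜ / 2) / 2))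
      (fun x hx => ball_mem_nhds _ (by have := hpos m x hx; positivity))
  choose t ht1 ht2 using hex
  refine ⟨t, fun m v hv => ⟨hpos m v (ht1 m v hv), (ht1 m v hv).2⟩, fun i x hx => ?_⟩
  have hex2 : ∃ m : ℕ, 1 / ((m : ℝ) + 1) ≤ infDist x Vᶜ := ⟨i, hx⟩
  have hm1 := Nat.find_spec hex2
  have hm2 := Nat.find_le (h := hex2) hx
  set m := Nat.find hex2 with hm
  have hxS : x ∈ S m := by
    refine ⟨hm1, ?_⟩
    rcases Nat.eq_zero_or_pos m with h0 | h0
    · rw [h0]; simp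
    · obtain ⟨j, hj⟩ : ∃ j, m = j + 1 := ⟨m - 1, by omega⟩
      have h3 := Nat.find_min hex2 (m := j) (by omega)
      rw [not_le, lt_div_iff₀ (by positivity)] at h3
      rw [hj]; push_cast; exact h3.le
  obtain ⟨v, hv, hxv⟩ := mem_iUnion₂.1 (ht2 m hxS)
  exact ⟨m, hm2, v, hv, (mem_ball.1 hxv).le⟩

lemma isClosed_msupport (n : ℕ) (μ : Measure (Euc n)) : IsClosed (msupport n μ) := by
  rw [← isOpen_compl_iff, Metric.isOpen_iff]
  intro x hx
  simp only [msupport, mem_compl_iff, mem_ofPred_eq, not_forall, not_lt] at hx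
  obtain ⟨r, hr, h0⟩ := hx
  refine ⟨r / 2, by positivity, fun y hy hy' => ?_⟩
  have h1 := hy' (r / 2) (by positivity)
  have h2 : ball y (r / 2) ⊆ ball x r := by
    refine ball_subset_ball' ?_
    rw [mem_ball] at hy; linarith
  exact absurd (h1.trans_le ((measure_mono h2).trans h0)) (lt_irrefl _)

lemma null_off_msupport (n : ℕ) (μ : Measure (Euc n)) (V : Set (Euc n))
    (hV : ∀ x ∈ V, x ∉ msupport n μ) : μ V = 0 := by
  refine measure_null_of_locally_null V fun x hx => ?_
  have h := hV x hx
  simp only [msupport, mem_ofPred_eq, not_forall, not_lt] at h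
  obtain ⟨r, hr, h0⟩ := h
  exact ⟨ball x r, mem_nhdsWithin_of_mem_nhds (ball_mem_nhds x hr), le_antisymm h0 bot_le⟩

section
variable {n d : ℕ} {U : Set (Euc n)} {Es : ℕ → Set (Euc n)} {μ : Measure (Euc n)}

lemma ev_fin (hfin : Filter.limsup (fun k => μH[(d : ℝ)] (U ∩ Es k)) atTop < ⊤) :
    ∀ᶠ k in atTop, μH[(d : ℝ)] (U ∩ Es k) < ⊤ :=
  eventually_lt_of_limsup_lt hfin

lemma meas_zero (hfin : Filter.limsup (fun k => μH[(d : ℝ)] (U ∩ Es k)) atTop < ⊤)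
    (hconv : WeakConv n (fun k => (μH[(d : ℝ)] : Measure (Euc n)).restrict (U ∩ Es k)) μ)
    (V T : Set (Euc n)) (hVo : IsOpen V) (hVU : V ⊆ U) (hV0 : μ V = 0) (hT : IsCompact T)
    (hTV : T ⊆ V) : Tendsto (fun k => μH[(d : ℝ)] (Es k ∩ T)) atTop (𝓝 0) := by
  obtain ⟨f, hf1, hf2, hf3, hf4⟩ := exists_continuousMap_one_of_isCompact_subset_isOpen hT hVo hTV
  have hlim := hconv f f.continuous hf2
  have h0 : ∫ x, f x ∂μ = 0 := by
    refine integral_eq_zero_of_ae ?_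
    have : ∀ᵐ x ∂μ, x ∉ V := measure_eq_zero_iff_ae_notMem.1 hV0
    filter_upwards [this] with x hx
    exact image_eq_zero_of_notMem_tsupport fun h => hx (hf3 h)
  rw [h0] at hlim
  have hlim2 := ENNReal.tendsto_ofReal hlim
  rw [ENNReal.ofReal_zero] at hlim2
  refine tendsto_of_tendsto_of_tendsto_of_le_of_le' tendsto_const_nhds hlim2
    (Eventually.of_forall fun _ => bot_le) ?_
  filter_upwards [ev_fin hfin] with k hk
  set ν := (μH[(d : ℝ)] : Measure (Euc n)).restrict (U ∩ Es k) with hν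
  haveI : IsFiniteMeasure ν := ⟨by rw [hν, Measure.restrict_apply_univ]; exact hk⟩
  have hfint : Integrable f ν := f.continuous.integrable_of_hasCompactSupport hf2
  rw [ofReal_integral_eq_lintegral_ofReal hfint (Eventually.of_forall fun x => (hf4 x).1)]
  have h1 : Es k ∩ T = T ∩ (U ∩ Es k) := by
    ext x
    exact ⟨fun h => ⟨h.2, hVU (hTV h.2), h.1⟩, fun h => ⟨h.2.2, h.1⟩⟩
  calc μH[(d : ℝ)] (Es k ∩ T) = ν T := by
        rw [hν, Measure.restrict_apply hT.measurableSet, h1]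
    _ = ∫⁻ x, T.indicator 1 x ∂ν := (lintegral_indicator_one hT.measurableSet).symm
    _ ≤ _ := by
        refine lintegral_mono fun x => ?_
        by_cases hx : x ∈ T
        · simp [hx, hf1 hx]
        · simp [hx]

lemma meas_pos (hUo : IsOpen U) (hEs : ∀ k, IsClosed (Es k)) [IsLocallyFiniteMeasure μ]
    (hfin : Filter.limsup (fun k => μH[(d : ℝ)] (U ∩ Es k)) atTop < ⊤)
    (hconv : WeakConv n (fun k => (μH[(d : ℝ)] : Measure (Euc n)).restrict (U ∩ Es k)) μ)
    (y : Euc n) (hy : y ∈ msupport n μ) (r : ℝ) (hr : 0 < r) :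
    ∃ c : ℝ≥0∞, 0 < c ∧ ∀ᶠ k in atTop, c < μH[(d : ℝ)] ((U ∩ Es k) ∩ ball y r) := by
  obtain ⟨f, hf1, hf2, hf3, hf4⟩ := exists_continuousMap_one_of_isCompact_subset_isOpen
    (isCompact_closedBall y (r / 2)) isOpen_ball (closedBall_subset_ball (show r / 2 < r by linarith))
  have hlim := hconv f f.continuous hf2
  have hpos : 0 < ∫ x, f x ∂μ := by
    rw [integral_pos_iff_support_of_nonneg (fun x => (hf4 x).1)
      (f.continuous.integrable_of_hasCompactSupport hf2)]
    refine (hy (r / 2) (by positivity)).trans_le (measure_mono fun x hx => ?_)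
    have := hf1 (ball_subset_closedBall hx)
    simp [Function.mem_support, this]
  refine ⟨ENNReal.ofReal ((∫ x, f x ∂μ) / 2), by simpa using hpos, ?_⟩
  filter_upwards [hlim.eventually_const_lt (show (∫ x, f x ∂μ) / 2 < ∫ x, f x ∂μ by linarith),
    ev_fin hfin] with k hk hkf
  set ν := (μH[(d : ℝ)] : Measure (Euc n)).restrict (U ∩ Es k) with hν
  haveI : IsFiniteMeasure ν := ⟨by rw [hν, Measure.restrict_apply_univ]; exact hkf⟩
  have hfint : Integrable f ν := f.continuous.integrable_of_hasCompactSupport hf2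
  have h2 : ENNReal.ofReal (∫ x, f x ∂ν) ≤ ν (ball y r) := by
    rw [ofReal_integral_eq_lintegral_ofReal hfint (Eventually.of_forall fun x => (hf4 x).1),
      ← lintegral_indicator_one measurableSet_ball]
    refine lintegral_mono fun x => ?_
    by_cases hx : x ∈ ball y r
    · simp only [hx, indicator_of_mem, Pi.one_apply]
      exact ENNReal.ofReal_le_one.2 (hf4 x).2
    · have : f x = 0 := image_eq_zero_of_notMem_tsupport fun h => hx (hf3 h)
      simp [this]
  have h3 : ν (ball y r) = μH[(d : ℝ)] ((U ∩ Es k) ∩ ball y r) := by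
    rw [hν, Measure.restrict_apply measurableSet_ball, inter_comm]
  rw [← h3]
  refine lt_of_lt_of_le ?_ h2
  exact (ENNReal.ofReal_lt_ofReal_iff (by linarith)).2 hk
end

lemma exists_subseq (n : ℕ) (R : ℝ) (X : ℕ → Set (Euc n)) (hX : ∀ i, X i ⊆ closedBall 0 R) :
    ∃ E : Set (Euc n), IsCompact E ∧ E ⊆ closedBall 0 R ∧ ∃ ψ : ℕ → ℕ, StrictMono ψ ∧
      Tendsto (fun i => hausdorffEDist (X (ψ i)) E) atTop (𝓝 0) := by
  haveI : CompactSpace (closedBall (0 : Euc n) R) :=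
    isCompact_iff_compactSpace.1 (isCompact_closedBall _ _)
  let Y : ℕ → TopologicalSpace.Closeds (closedBall (0 : Euc n) R) := fun i =>
    ⟨closure (Subtype.val ⁻¹' (X i)), isClosed_closure⟩
  obtain ⟨Z, ψ, hψ, hZ⟩ := CompactSpace.tendsto_subseq Y
  refine ⟨Subtype.val '' (Z : Set (closedBall (0 : Euc n) R)),
    Z.isClosed.isCompact.image continuous_subtype_val, ?_, ψ, hψ, ?_⟩
  · rintro _ ⟨x, -, rfl⟩
    exact x.2
  · rw [tendsto_iff_edist_tendsto_0] at hZ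
    refine hZ.congr fun i => ?_
    change hausdorffEDist (closure (Subtype.val ⁻¹' (X (ψ i)))) (Z : Set (closedBall (0 : Euc n) R)) = _
    rw [hausdorffEDist_closure_left, ← hausdorffEDist_image (isometry_subtype_coe),
      Subtype.image_preimage_coe, inter_eq_right.2 (hX _)]

end Haircut

/-- Lemma 5.4: Haircut lemma. Given closed sets `E_k` with `U ∩ E_k`
uniformly bounded, `limsup H^d(U ∩ E_k) < ∞` and `H^d ⌞ (U ∩ E_k) ⇀ μ`, for every `τ > 0`
there are a subsequence `E_{k_i}`, a compact set `E`, and deformations `φ_i ∈ D(ℝⁿ,U)` with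
`‖φ_i − id‖ ≤ τ`, such that `H^d(φ_i(E_{k_i}) △ E_{k_i}) → 0`, `U ∩ spt μ ⊆ E`,
`H^d(U ∩ E ∖ spt μ) = 0`, and `φ_i(U ∩ E_{k_i}) → E` locally in `U` in Hausdorff distance. -/
theorem haircut_lemma
    (n d : ℕ) (hd : 1 ≤ d) (hdn : d < n)
    (U : Set (Euc n)) (hUopen : IsOpen U)
    (Es : ℕ → Set (Euc n)) (hEsclosed : ∀ k, IsClosed (Es k))
    (hbdd : ∃ R : ℝ, ∀ k, U ∩ Es k ⊆ closedBall 0 R)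
    (hfin : Filter.limsup (fun k => μH[(d : ℝ)] (U ∩ Es k)) atTop < ⊤)
    (μ : Measure (Euc n)) (hμ : IsLocallyFiniteMeasure μ)
    (hconv : WeakConv n (fun k => (μH[(d : ℝ)] : Measure (Euc n)).restrict (U ∩ Es k)) μ) :
    ∀ τ : ℝ, 0 < τ →
    ∃ ki : ℕ → ℕ, StrictMono ki ∧
    ∃ E : Set (Euc n), IsCompact E ∧
    ∃ φs : ℕ → Euc n → Euc n,
      (∀ i, IsDeformation n U (φs i)) ∧
      (∀ i, ∀ x : Euc n, dist (φs i x) x ≤ τ) ∧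
      -- (i)
      Tendsto (fun i => μH[(d : ℝ)] (symmDiff (φs i '' Es (ki i)) (Es (ki i)))) atTop
        (𝓝 0) ∧
      -- (ii)
      U ∩ msupport n μ ⊆ E ∧
      μH[(d : ℝ)] ((U ∩ E) \ msupport n μ) = 0 ∧
      -- (iii) local Hausdorff convergence in U
      (∀ K : Set (Euc n), IsCompact K → K ⊆ U → ∀ η : ℝ, 0 < η →
        ∀ᶠ i in atTop,
          (φs i '' (U ∩ Es (ki i))) ∩ K ⊆ {y | infDist y E ≤ η} ∧
          E ∩ K ⊆ {y | infDist y (φs i '' (U ∩ Es (ki i))) ≤ η}) := by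
  intro τ hτ
  classical
  obtain ⟨R, hR⟩ := hbdd
  set V : Set (Euc n) := (U ∩ ball 0 (R + τ + 1)) \ msupport n μ with hVdef
  have hVo : IsOpen V := (hUopen.inter isOpen_ball).sdiff (Haircut.isClosed_msupport n μ)
  have hVb : Bornology.IsBounded V := isBounded_ball.subset fun x hx => hx.1.2
  have hVU : V ⊆ U := fun x hx => hx.1.1
  have hV0 : μ V = 0 := Haircut.null_off_msupport n μ V fun x hx => hx.2
  have hVc : (Vᶜ).Nonempty := by
    haveI : Nonempty (Fin n) := ⟨⟨0, by omega⟩⟩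
    obtain ⟨x, hx⟩ := NormedSpace.exists_lt_norm ℝ (Euc n) (R + τ + 1)
    refine ⟨x, fun h => ?_⟩
    have := h.1.2
    rw [mem_ball_zero_iff] at this
    linarith
  obtain ⟨t, ht1, ht2⟩ := Haircut.exists_cover n V hVo hVb hVc τ hτ
  set D : Euc n → ℝ := fun x => infDist x Vᶜ with hD
  have hDV : ∀ x, 0 < D x → x ∈ V := by
    intro x hx
    by_contra h
    have : D x = 0 := infDist_zero_of_mem h
    linarith
  have hVD : ∀ x ∈ V, 0 < D x := fun x hx =>
    (hVo.isClosed_compl.notMem_iff_infDist_pos hVc).1 (not_not.2 hx)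
  have hDl : ∀ x y, D x ≤ D y + dist x y := fun x y => infDist_le_infDist_add_dist
  set ρ : Euc n → ℝ := fun v => min τ (D v / 2) with hρ
  have hρτ : ∀ v, ρ v ≤ τ := fun v => min_le_left _ _
  have hρD : ∀ v, ρ v ≤ D v / 2 := fun v => min_le_right _ _
  set I : ℕ → Finset (Euc n) := fun i => (Finset.range (i + 1)).biUnion t with hI
  have hmemI : ∀ i v, v ∈ I i ↔ ∃ m ≤ i, v ∈ t m := by
    intro i v
    simp [hI, Nat.lt_succ_iff]
  have hIpos : ∀ i, ∀ v ∈ I i, 0 < D v := by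
    intro i v hv
    obtain ⟨m, -, hm⟩ := (hmemI i v).1 hv
    exact (ht1 m v hm).1
  have hρpos : ∀ i, ∀ v ∈ I i, 0 < ρ v := fun i v hv =>
    lt_min hτ (half_pos (hIpos i v hv))
  set T : ℕ → Set (Euc n) := fun i => ⋃ v ∈ I i, closedBall v (ρ v) with hT
  have hTc : ∀ i, IsCompact (T i) := fun i =>
    (I i).isCompact_biUnion fun v _ => isCompact_closedBall _ _
  have hTV : ∀ i, T i ⊆ V := by
    intro i x hx
    obtain ⟨v, hv, hxv⟩ := mem_iUnion₂.1 hx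
    rw [mem_closedBall] at hxv
    refine hDV x ?_
    have h1 := hDl v x
    rw [dist_comm] at h1
    linarith [hρD v, hIpos i v hv]
  have hlim : ∀ i, Tendsto (fun k => μH[(d : ℝ)] (Es k ∩ T i)) atTop (𝓝 0) := fun i =>
    Haircut.meas_zero hfin hconv V (T i) hVo hVU hV0 (hTc i) (hTV i)
  set e : ℕ → ℝ≥0 := fun i => 1 / ((i : ℝ≥0) + 1) with he
  have he0 : ∀ i, 0 < e i := fun i => by positivity
  have helim : Tendsto (fun i => (e i : ℝ≥0∞)) atTop (𝓝 0) := by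
    rw [← ENNReal.coe_zero, ENNReal.tendsto_coe]
    exact tendsto_one_div_add_atTop_nhds_zero_nat
  choose δ hδ hst using fun i => Haircut.stage n d hd (I i) ρ (hρpos i) (e i) (he0 i)
  obtain ⟨k, hk, hkm⟩ := extraction_forall_of_eventually (fun i =>
    (hlim i).eventually_lt_const (show (0 : ℝ≥0∞) < ((min (δ i) (e i) : ℝ≥0) : ℝ≥0∞) by
      exact_mod_cast lt_min (hδ i) (he0 i)))
  choose φ hφlip hφmv hφm hφhull using fun i => hst i (Es (k i) ∩ T i)
    ((hTc i).inter_left (hEsclosed _))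
    ((hkm i).trans_le (by exact_mod_cast min_le_left _ _))
  have hφT : ∀ i x, φ i x ≠ x → x ∈ T i := by
    intro i x hx
    obtain ⟨v, hv, h1, -⟩ := hφmv i x hx
    exact mem_biUnion hv h1.le
  have hcl : ∀ i, closure {x | φ i x ≠ x} ⊆ T i := fun i =>
    closure_minimal (fun x hx => hφT i x hx) (hTc i).isClosed
  have hdef : ∀ i, IsDeformation n U (φ i) := by
    intro i
    obtain ⟨K, hK⟩ := hφlip i
    refine ⟨⟨K, hK⟩, ⟨hK.continuous, ?_⟩, ?_, ?_⟩
    · exact ⟨ContinuousMap.Homotopy.affine _ _⟩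
    · exact (hTc i).of_isClosed_subset isClosed_closure (hcl i)
    · exact (hcl i).trans ((hTV i).trans hVU)
  have hdist : ∀ i x, dist (φ i x) x ≤ τ := by
    intro i x
    by_cases h : φ i x = x
    · rw [h, dist_self]; exact hτ.le
    · obtain ⟨v, -, -, h2⟩ := hφmv i x h
      exact h2.trans (hρτ v)
  have hsd : ∀ i, μH[(d : ℝ)] (symmDiff (φ i '' Es (k i)) (Es (k i))) ≤ e i + e i := by
    intro i
    have hsub : symmDiff (φ i '' Es (k i)) (Es (k i)) ⊆
        φ i '' (Es (k i) ∩ T i) ∪ (Es (k i) ∩ T i) := by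
      rintro z (⟨⟨x, hx, rfl⟩, hz⟩ | ⟨hz, hz'⟩)
      · left
        refine ⟨x, ⟨hx, hφT i x fun h => hz ?_⟩, rfl⟩
        rw [h]; exact hx
      · right
        exact ⟨hz, hφT i z fun h => hz' ⟨z, hz, h⟩⟩
    refine (measure_mono hsub).trans ((measure_union_le _ _).trans (add_le_add (hφm i) ?_))
    exact (hkm i).le.trans (by exact_mod_cast min_le_right _ _)
  have hsdlim : Tendsto (fun i => μH[(d : ℝ)] (symmDiff (φ i '' Es (k i)) (Es (k i)))) atTop
      (𝓝 0) := by
    have h2 := helim.add helim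
    rw [add_zero] at h2
    exact tendsto_of_tendsto_of_tendsto_of_le_of_le tendsto_const_nhds h2 (fun _ => bot_le) hsd
  have hX : ∀ i, φ i '' (U ∩ Es (k i)) ⊆ closedBall 0 (R + τ) := by
    rintro i _ ⟨x, hx, rfl⟩
    have h1 := hR _ hx
    rw [mem_closedBall] at h1 ⊢
    linarith [dist_triangle (φ i x) x 0, hdist i x]
  obtain ⟨E, hEc, hER, ψ, hψ, hHd⟩ := Haircut.exists_subseq n (R + τ) _ hX
  refine ⟨k ∘ ψ, hk.comp hψ, E, hEc, φ ∘ ψ, fun i => hdef _, fun i x => hdist _ x,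
    hsdlim.comp hψ.tendsto_atTop, ?_, ?_, ?_⟩
  · rintro y ⟨hyU, hyμ⟩
    rw [← hEc.isClosed.closure_eq, Metric.mem_closure_iff]
    intro ε hε
    obtain ⟨c, hc, hev⟩ := Haircut.meas_pos hUopen hEsclosed hfin hconv y hyμ (ε / 2) (half_pos hε)
    have hev1 := (hk.comp hψ).tendsto_atTop.eventually hev
    have hev2 := (hsdlim.comp hψ.tendsto_atTop).eventually_lt_const hc
    have hev3 := hHd.eventually_lt_const (show (0 : ℝ≥0∞) < ENNReal.ofReal (ε / 2) by
      simpa using hε)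
    obtain ⟨i, h1, h2, h3⟩ := (hev1.and (hev2.and hev3)).exists
    obtain ⟨z, hz, hzφ⟩ : ∃ z ∈ (U ∩ Es (k (ψ i))) ∩ ball y (ε / 2),
        z ∈ φ (ψ i) '' Es (k (ψ i)) := by
      by_contra hcon
      push Not at hcon
      have : (U ∩ Es (k (ψ i))) ∩ ball y (ε / 2) ⊆
          symmDiff (φ (ψ i) '' Es (k (ψ i))) (Es (k (ψ i))) := fun z hz =>
        Or.inr ⟨hz.1.2, hcon z hz⟩
      exact absurd (h1.trans_le (measure_mono this)) (not_lt.2 h2.le)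
    obtain ⟨x, hx, rfl⟩ := hzφ
    have hxU : x ∈ U := by
      by_contra hxU
      have : φ (ψ i) x = x := by
        by_contra h
        exact hxU (hVU (hTV _ (hφT _ x h)))
      rw [this] at hz
      exact hxU hz.1.1
    obtain ⟨w, hw, hzw⟩ := exists_edist_lt_of_hausdorffEDist_lt
      (show φ (ψ i) x ∈ φ (ψ i) '' (U ∩ Es (k (ψ i))) from ⟨x, ⟨hxU, hx⟩, rfl⟩) h3
    refine ⟨w, hw, ?_⟩
    rw [edist_lt_ofReal] at hzw
    have h4 := mem_ball'.1 hz.2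
    linarith [dist_triangle y (φ (ψ i) x) w]
  · let P : ℕ → Set (Euc n) := fun M => ⋃ J ∈ (I M).powerset.filter (fun J => J.card ≤ d),
      convexHull ℝ (J : Set (Euc n))
    have hPnull : ∀ M, μH[(d : ℝ)] (P M) = 0 := fun M => by
      refine (measure_biUnion_null_iff (Finset.countable_toSet _)).2 fun J hJ => ?_
      exact Haircut.hull_null n d hd J (Finset.mem_filter.1 hJ).2
    have hPcl : ∀ M, IsClosed (P M) := fun M =>
      (Finset.isCompact_biUnion _ fun J _ => J.finite_toSet.isCompact_convexHull (𝕜 := ℝ)).isClosed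
    refine measure_mono_null ?_ (measure_iUnion_null hPnull)
    rintro y ⟨⟨hyU, hyE⟩, hyμ⟩
    have hyV : y ∈ V := by
      refine ⟨⟨hyU, ?_⟩, hyμ⟩
      have := hER hyE
      rw [mem_closedBall] at this
      rw [mem_ball]
      linarith
    have hDy := hVD y hyV
    obtain ⟨c, hc, hcy⟩ : ∃ c : ℝ, 0 < c ∧ D y = 4 * c := ⟨D y / 4, by positivity, by ring⟩
    obtain ⟨M, hM⟩ := exists_nat_gt (3 / (2 * c))
    refine mem_iUnion.2 ⟨M, ?_⟩
    rw [← (hPcl M).closure_eq, Metric.mem_closure_iff]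
    intro ε hε
    have hev3 := hHd.eventually_lt_const
      (show (0 : ℝ≥0∞) < ENNReal.ofReal (min ε c) by simp [hε, hc])
    have hev4 : ∀ᶠ i in atTop, 1 / ((ψ i : ℝ) + 1) < c :=
      (tendsto_one_div_add_atTop_nhds_zero_nat.comp hψ.tendsto_atTop).eventually_lt_const hc
    obtain ⟨i, h3, h4⟩ := (hev3.and hev4).exists
    rw [hausdorffEDist_comm] at h3
    obtain ⟨_, ⟨x, hx, rfl⟩, hxy⟩ := exists_edist_lt_of_hausdorffEDist_lt hyE h3
    rw [edist_lt_ofReal, lt_min_iff] at hxy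
    refine ⟨φ (ψ i) x, ?_, hxy.1⟩
    have h5 := hDl y (φ (ψ i) x)
    have hDx : c ≤ D x := by
      by_cases hfx : φ (ψ i) x = x
      · rw [hfx] at h5 hxy
        linarith [hxy.2]
      · obtain ⟨v, -, h6, h7⟩ := hφmv (ψ i) x hfx
        have h8 := hDl (φ (ψ i) x) x
        have h9 := hDl v x
        rw [dist_comm v x] at h9
        linarith [hxy.2, hρD v]
    obtain ⟨m, hm, v, hv, hxv⟩ := ht2 (ψ i) x (h4.le.trans hDx)
    have hvI : v ∈ I (ψ i) := (hmemI _ _).2 ⟨m, hm, hv⟩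
    have hxT : x ∈ T (ψ i) := by
      refine mem_biUnion hvI ?_
      rw [mem_closedBall]
      have h6 : dist x v ≤ ρ v / 2 := hxv
      linarith [hρpos _ v hvI]
    obtain ⟨J, hJ1, hJ2, hJ3, hJ4⟩ := hφhull (ψ i) x ⟨hx.2, hxT⟩ ⟨v, hvI, hxv⟩
    refine mem_biUnion ?_ hJ4
    refine Finset.mem_coe.2 (Finset.mem_filter.2 ⟨Finset.mem_powerset.2 fun w hw => ?_, hJ2⟩)
    obtain ⟨m', -, hm'⟩ := (hmemI _ _).1 (hJ1 hw)
    refine (hmemI _ _).2 ⟨m', ?_, hm'⟩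
    have h6 := hJ3 w hw
    have h7 := hDl x w
    have h8 : 2 * c / 3 ≤ D w := by linarith [hρD w]
    have h9 : D w * m' ≤ 1 := (ht1 m' w hm').2
    have h10 : 2 * c / 3 * m' ≤ 1 := (by gcongr : 2 * c / 3 * (m' : ℝ) ≤ D w * m').trans h9
    have h11 : (m' : ℝ) ≤ 3 / (2 * c) := by
      rw [le_div_iff₀ (by positivity)]; linarith
    exact_mod_cast (h11.trans hM.le)
  · intro K _ _ η hη
    filter_upwards [hHd.eventually_lt_const (show (0 : ℝ≥0∞) < ENNReal.ofReal η by simpa using hη)]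
      with i hi
    constructor
    · rintro z ⟨hz, -⟩
      refine ENNReal.toReal_le_of_le_ofReal hη.le ?_
      exact (infEDist_le_hausdorffEDist_of_mem hz).trans hi.le
    · rintro z ⟨hz, -⟩
      refine ENNReal.toReal_le_of_le_ofReal hη.le ?_
      rw [hausdorffEDist_comm] at hi
      exact (infEDist_le_hausdorffEDist_of_mem hz).trans hi.le
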